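/- arXiv:1501.04438 — 7 statements merged into one kernel-verified Lean document; each statement's English description precedes it below -/
import Mathlib

section
/- Let σ > 0 and define ρ(x) = e^{−‖x‖²/σ²} on ℝ³. Then for every x ∈ ℝ³ with x ≠ 0, the 3D Coulomb potential satisfies ∫_{ℝ³} ρ(y)/(4π‖x − y‖) dy = (σ³ √π /(4‖x‖)) · Erf(‖x‖/σ), where Erf(r) = (2/√π) ∫_0^r e^{−t²} dt is the error function; equivalently, the left-hand side equals (σ³/(2‖x‖)) ∫_0^{‖x‖/σ} e^{−t²} dt. -/
open MeasureTheory

/-- The error function `Erf(r) = (2/√π) ∫_0^r e^{−t²} dt`. -/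
noncomputable def errorFunction (r : ℝ) : ℝ :=
  (2 / Real.sqrt Real.pi) * ∫ t in (0 : ℝ)..r, Real.exp (-t ^ 2)

open Set Filter Topology

/-- Completing the square in the product of two Gaussians, one of them centred at `x`. -/
lemma norm_sq_div_add_mul_norm_sub_sq {V : Type*} [NormedAddCommGroup V]
    [InnerProductSpace ℝ V] {σ : ℝ} (hσ : 0 < σ) (x y : V) (s : ℝ) :
    ‖y‖ ^ 2 / σ ^ 2 + ‖x - y‖ ^ 2 * s ^ 2 =
      (1 + σ ^ 2 * s ^ 2) / σ ^ 2 * ‖y - (σ ^ 2 * s ^ 2 / (1 + σ ^ 2 * s ^ 2)) • x‖ ^ 2 +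
        (‖x‖ * s / √(1 + σ ^ 2 * s ^ 2)) ^ 2 := by
  have h : 0 < 1 + σ ^ 2 * s ^ 2 := by positivity
  rw [norm_sub_sq_real, norm_sub_sq_real, inner_smul_right, norm_smul, mul_pow, Real.norm_eq_abs,
    sq_abs, div_pow, div_pow, Real.sq_sqrt h.le, real_inner_comm x y]
  field_simp
  ring

/-- The integral of the product of two Gaussians on `ℝ³`. -/
lemma integral_exp_mul_exp_euclideanSpace {σ : ℝ} (hσ : 0 < σ)
    (x : EuclideanSpace ℝ (Fin 3)) (s : ℝ) :
    ∫ y : EuclideanSpace ℝ (Fin 3),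
        Real.exp (-‖y‖ ^ 2 / σ ^ 2) * Real.exp (-‖x - y‖ ^ 2 * s ^ 2) =
      Real.pi * √Real.pi * σ ^ 3 / √(1 + σ ^ 2 * s ^ 2) ^ 3 *
        Real.exp (-(‖x‖ * s / √(1 + σ ^ 2 * s ^ 2)) ^ 2) := by
  have h : 0 < 1 + σ ^ 2 * s ^ 2 := by positivity
  have key : ∀ y : EuclideanSpace ℝ (Fin 3),
      Real.exp (-‖y‖ ^ 2 / σ ^ 2) * Real.exp (-‖x - y‖ ^ 2 * s ^ 2) =
        Real.exp (-((1 + σ ^ 2 * s ^ 2) / σ ^ 2) *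
          ‖y - (σ ^ 2 * s ^ 2 / (1 + σ ^ 2 * s ^ 2)) • x‖ ^ 2) *
          Real.exp (-(‖x‖ * s / √(1 + σ ^ 2 * s ^ 2)) ^ 2) := by
    intro y
    rw [← Real.exp_add, ← Real.exp_add]
    congr 1
    linear_combination -norm_sq_div_add_mul_norm_sub_sq hσ x y s
  simp_rw [key]
  rw [integral_mul_const, integral_sub_right_eq_self (fun y : EuclideanSpace ℝ (Fin 3) ↦
      Real.exp (-((1 + σ ^ 2 * s ^ 2) / σ ^ 2) * ‖y‖ ^ 2)),
    GaussianFourier.integral_rexp_neg_mul_sq_norm (by positivity), finrank_euclideanSpace_fin]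
  congr 1
  rw [show ((3 : ℕ) : ℝ) / 2 = 1 / 2 * (3 : ℕ) by norm_num, Real.rpow_mul (by positivity),
    ← Real.sqrt_eq_rpow, Real.rpow_natCast,
    show Real.pi / ((1 + σ ^ 2 * s ^ 2) / σ ^ 2) = Real.pi * σ ^ 2 / (1 + σ ^ 2 * s ^ 2) by
      field_simp,
    Real.sqrt_div (by positivity), Real.sqrt_mul Real.pi_pos.le, Real.sqrt_sq hσ.le, div_pow,
    mul_pow, pow_succ √Real.pi 2, Real.sq_sqrt Real.pi_pos.le]

lemma hasDerivAt_mul_div_sqrt_one_add (r σ s : ℝ) :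
    HasDerivAt (fun s ↦ r * s / √(1 + σ ^ 2 * s ^ 2)) (r / √(1 + σ ^ 2 * s ^ 2) ^ 3) s := by
  have h : 0 < 1 + σ ^ 2 * s ^ 2 := by positivity
  have hq : HasDerivAt (fun s : ℝ ↦ 1 + σ ^ 2 * s ^ 2) (σ ^ 2 * (2 * s)) s := by
    simpa using ((hasDerivAt_pow 2 s).const_mul (σ ^ 2)).const_add 1
  have hs := Real.sqrt_pos.2 h
  refine (((hasDerivAt_id s).const_mul r).div (hq.sqrt h.ne') hs.ne').congr_deriv ?_
  have hsq := Real.sq_sqrt h.le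
  simp only [id]
  field_simp
  linear_combination r * hsq

lemma tendsto_mul_div_sqrt_one_add (r : ℝ) {σ : ℝ} (hσ : 0 < σ) :
    Tendsto (fun s ↦ r * s / √(1 + σ ^ 2 * s ^ 2)) atTop (𝓝 (r / σ)) := by
  have h : Tendsto (fun s : ℝ ↦ r / √((s⁻¹) ^ 2 + σ ^ 2)) atTop (𝓝 (r / √(0 ^ 2 + σ ^ 2))) :=
    tendsto_const_nhds.div ((tendsto_inv_atTop_zero.pow 2).add_const _).sqrt (by positivity)
  rw [zero_pow two_ne_zero, zero_add, Real.sqrt_sq hσ.le] at h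
  refine h.congr' ?_
  filter_upwards [eventually_gt_atTop 0] with s hs
  rw [show 1 + σ ^ 2 * s ^ 2 = ((s⁻¹) ^ 2 + σ ^ 2) * s ^ 2 by field_simp,
    Real.sqrt_mul (by positivity), Real.sqrt_sq hs.le]
  field_simp

/-- The substitution `t = r s / √(1 + σ² s²)` in the integral of `exp (-t²)`. -/
lemma integrableOn_and_integral_Ioi_exp_neg_sq_comp {r σ : ℝ} (hr : 0 ≤ r) (hσ : 0 < σ) :
    IntegrableOn (fun s ↦ Real.exp (-(r * s / √(1 + σ ^ 2 * s ^ 2)) ^ 2) *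
        (r / √(1 + σ ^ 2 * s ^ 2) ^ 3)) (Ioi 0) ∧
      ∫ s in Ioi (0 : ℝ), Real.exp (-(r * s / √(1 + σ ^ 2 * s ^ 2)) ^ 2) *
        (r / √(1 + σ ^ 2 * s ^ 2) ^ 3) = ∫ t in (0 : ℝ)..(r / σ), Real.exp (-t ^ 2) := by
  have hc : Continuous fun t : ℝ ↦ Real.exp (-t ^ 2) := by fun_prop
  have hE (u : ℝ) : HasDerivAt (fun u ↦ ∫ t in (0 : ℝ)..u, Real.exp (-t ^ 2))
      (Real.exp (-u ^ 2)) u := hc.integral_hasStrictDerivAt 0 u |>.hasDerivAt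
  have hG (s : ℝ) := (hE _).comp s (hasDerivAt_mul_div_sqrt_one_add r σ s)
  have hlim := (hE (r / σ)).continuousAt.tendsto.comp (tendsto_mul_div_sqrt_one_add r hσ)
  have hpos (s : ℝ) : 0 ≤ Real.exp (-(r * s / √(1 + σ ^ 2 * s ^ 2)) ^ 2) *
      (r / √(1 + σ ^ 2 * s ^ 2) ^ 3) := by positivity
  refine ⟨integrableOn_Ioi_deriv_of_nonneg' (fun s _ ↦ hG s) (fun s _ ↦ hpos s) hlim, ?_⟩
  rw [integral_Ioi_of_hasDerivAt_of_nonneg' (fun s _ ↦ hG s) (fun s _ ↦ hpos s) hlim]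
  simp

/-- The Coulomb kernel as a superposition of Gaussians. -/
lemma integral_Ioi_exp_neg_sq_mul_sq {r : ℝ} (hr : 0 ≤ r) :
    ∫ s in Ioi (0 : ℝ), Real.exp (-r ^ 2 * s ^ 2) = √Real.pi / (2 * r) := by
  rw [integral_gaussian_Ioi, Real.sqrt_div Real.pi_pos.le, Real.sqrt_sq hr, div_div, mul_comm r]

lemma integrable_exp_mul_exp_euclideanSpace {σ : ℝ} (hσ : 0 < σ)
    {x : EuclideanSpace ℝ (Fin 3)} (hx : x ≠ 0) :
    Integrable (Function.uncurry fun (s : ℝ) (y : EuclideanSpace ℝ (Fin 3)) ↦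
        Real.exp (-‖y‖ ^ 2 / σ ^ 2) * Real.exp (-‖x - y‖ ^ 2 * s ^ 2))
      ((volume.restrict (Ioi 0)).prod volume) := by
  have hr : 0 < ‖x‖ := norm_pos_iff.2 hx
  rw [integrable_prod_iff (Continuous.aestronglyMeasurable (by
    unfold Function.uncurry; fun_prop))]
  refine ⟨ae_of_all _ fun s ↦ ?_, ?_⟩
  · refine Integrable.of_integral_ne_zero ?_
    simp only [Function.uncurry]
    rw [integral_exp_mul_exp_euclideanSpace hσ]
    positivity
  · simp only [Function.uncurry, norm_mul, Real.norm_eq_abs, Real.abs_exp,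
      integral_exp_mul_exp_euclideanSpace hσ]
    refine ((integrableOn_and_integral_Ioi_exp_neg_sq_comp hr.le hσ).1.const_mul
      (Real.pi * √Real.pi * σ ^ 3 / ‖x‖)).congr (ae_of_all _ fun s ↦ ?_)
    simp only
    field_simp

lemma integral_gaussian_div_norm_sub {σ : ℝ} (hσ : 0 < σ)
    {x : EuclideanSpace ℝ (Fin 3)} (hx : x ≠ 0) :
    ∫ y : EuclideanSpace ℝ (Fin 3),
        Real.exp (-‖y‖ ^ 2 / σ ^ 2) / (4 * Real.pi * ‖x - y‖) =
      (σ ^ 3 / (2 * ‖x‖)) * ∫ t in (0 : ℝ)..(‖x‖ / σ), Real.exp (-t ^ 2) := by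
  have hr : 0 < ‖x‖ := norm_pos_iff.2 hx
  have hπ := Real.pi_pos
  calc
    _ = ∫ y : EuclideanSpace ℝ (Fin 3), 1 / (2 * Real.pi * √Real.pi) *
        ∫ s in Ioi (0 : ℝ), Real.exp (-‖y‖ ^ 2 / σ ^ 2) * Real.exp (-‖x - y‖ ^ 2 * s ^ 2) := by
      congr 1 with y
      rw [integral_const_mul, integral_Ioi_exp_neg_sq_mul_sq (norm_nonneg _)]
      field_simp
      norm_num
    _ = 1 / (2 * Real.pi * √Real.pi) * ∫ s in Ioi (0 : ℝ), ∫ y : EuclideanSpace ℝ (Fin 3),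
        Real.exp (-‖y‖ ^ 2 / σ ^ 2) * Real.exp (-‖x - y‖ ^ 2 * s ^ 2) := by
      rw [integral_const_mul, integral_integral_swap (integrable_exp_mul_exp_euclideanSpace hσ hx)]
    _ = 1 / (2 * Real.pi * √Real.pi) * ∫ s in Ioi (0 : ℝ),
        Real.pi * √Real.pi * σ ^ 3 / ‖x‖ *
          (Real.exp (-(‖x‖ * s / √(1 + σ ^ 2 * s ^ 2)) ^ 2) *
            (‖x‖ / √(1 + σ ^ 2 * s ^ 2) ^ 3)) := by
      congr 2 with s
      rw [integral_exp_mul_exp_euclideanSpace hσ]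
      field_simp
    _ = _ := by
      rw [integral_const_mul, (integrableOn_and_integral_Ioi_exp_neg_sq_comp hr.le hσ).2]
      field_simp

/-- The 3D Coulomb potential of the Gaussian `ρ(x) = e^{−‖x‖²/σ²}`:
for `x ≠ 0`, `∫ ρ(y)/(4π‖x−y‖) dy = (σ³√π/(4‖x‖)) Erf(‖x‖/σ)
= (σ³/(2‖x‖)) ∫_0^{‖x‖/σ} e^{−t²} dt`. -/
theorem coulomb3d_gaussian_potential (σ : ℝ) (hσ : 0 < σ)
    (x : EuclideanSpace ℝ (Fin 3)) (hx : x ≠ 0) :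
    (∫ y : EuclideanSpace ℝ (Fin 3),
        Real.exp (-‖y‖ ^ 2 / σ ^ 2) / (4 * Real.pi * ‖x - y‖)) =
      ((σ ^ 3 * Real.sqrt Real.pi) / (4 * ‖x‖)) * errorFunction (‖x‖ / σ) ∧
    (∫ y : EuclideanSpace ℝ (Fin 3),
        Real.exp (-‖y‖ ^ 2 / σ ^ 2) / (4 * Real.pi * ‖x - y‖)) =
      (σ ^ 3 / (2 * ‖x‖)) * ∫ t in (0 : ℝ)..(‖x‖ / σ), Real.exp (-t ^ 2) := by
  have h := integral_gaussian_div_norm_sub hσ hx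
  refine ⟨?_, h⟩
  rw [h, errorFunction]
  have hr : 0 < ‖x‖ := norm_pos_iff.2 hx
  have hπ := Real.pi_pos
  field_simp
  ring
end

section
/- Let σ > 0 and γ > 0 with γ ≠ 1, and define the anisotropic Gaussian density ρ(x) = e^{−(x₁² + x₂² + γ² x₃²)/σ²} on ℝ³. Then for every x = (x₁, x₂, x₃) ∈ ℝ³, ∫_{ℝ³} ρ(y)/(4π‖x − y‖) dy = (σ²/(4γ)) ∫_0^∞ e^{−(x₁² + x₂²)/(σ²(t + 1))} · e^{−x₃²/(σ²(t + γ^{−2}))} / ((t + 1) √(t + γ^{−2})) dt. -/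
open MeasureTheory

/-- Tonelli's theorem for Bochner integrals of nonnegative real functions, assuming only that the
sections are integrable. -/
theorem integral_integral_swap_of_nonneg {α β : Type*} [MeasurableSpace α] [MeasurableSpace β]
    {μ : Measure α} {ν : Measure β} [SFinite μ] [SFinite ν] {F : α → β → ℝ}
    (hF : Measurable (Function.uncurry F)) (hF0 : ∀ x y, 0 ≤ F x y)
    (hx : ∀ᵐ x ∂μ, Integrable (F x) ν) (hy : ∀ᵐ y ∂ν, Integrable (fun x => F x y) μ) :
    ∫ x, ∫ y, F x y ∂ν ∂μ = ∫ y, ∫ x, F x y ∂μ ∂ν := by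
  rw [integral_eq_lintegral_of_nonneg_ae, integral_eq_lintegral_of_nonneg_ae]
  · congr 1
    have h₁ : ∫⁻ x, ENNReal.ofReal (∫ y, F x y ∂ν) ∂μ
        = ∫⁻ x, ∫⁻ y, ENNReal.ofReal (F x y) ∂ν ∂μ := by
      refine lintegral_congr_ae ?_
      filter_upwards [hx] with x h
      exact ofReal_integral_eq_lintegral_ofReal h (ae_of_all _ (hF0 x))
    have h₂ : ∫⁻ y, ENNReal.ofReal (∫ x, F x y ∂μ) ∂ν
        = ∫⁻ y, ∫⁻ x, ENNReal.ofReal (F x y) ∂μ ∂ν := by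
      refine lintegral_congr_ae ?_
      filter_upwards [hy] with y h
      exact ofReal_integral_eq_lintegral_ofReal h (ae_of_all _ fun x => hF0 x y)
    rw [h₁, h₂]
    exact lintegral_lintegral_swap hF.ennreal_ofReal.aemeasurable
  · exact ae_of_all _ fun y => integral_nonneg fun x => hF0 x y
  · exact (hF.stronglyMeasurable.integral_prod_left (μ := μ)).aestronglyMeasurable
  · exact ae_of_all _ fun x => integral_nonneg fun y => hF0 x y
  · exact (hF.stronglyMeasurable.integral_prod_right (ν := ν)).aestronglyMeasurable

theorem gaussian_comp_rpow_neg_half {a t : ℝ} (ht : 0 < t) :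
    (|(-1 / 2 : ℝ)| * t ^ ((-1 / 2 : ℝ) - 1)) • Real.exp (-a * (t ^ (-1 / 2 : ℝ)) ^ 2)
      = 1 / 2 * ((Real.sqrt t ^ 3)⁻¹ * Real.exp (-a / t)) := by
  have h₁ : t ^ ((-1 / 2 : ℝ) - 1) = (Real.sqrt t ^ 3)⁻¹ := by
    rw [Real.sqrt_eq_rpow, ← Real.rpow_natCast, ← Real.rpow_mul ht.le, ← Real.rpow_neg ht.le]
    norm_num
  have h₂ : (t ^ (-1 / 2 : ℝ)) ^ 2 = t⁻¹ := by
    rw [← Real.rpow_natCast, ← Real.rpow_mul ht.le, ← Real.rpow_neg_one]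
    norm_num
  rw [h₁, h₂, show |(-1 / 2 : ℝ)| = 1 / 2 by norm_num [abs_of_neg], smul_eq_mul, mul_assoc,
    div_eq_mul_inv (-a) t]

theorem integrableOn_inv_sqrt_cube_mul_exp_neg_div {a : ℝ} (ha : 0 < a) :
    IntegrableOn (fun t : ℝ => (Real.sqrt t ^ 3)⁻¹ * Real.exp (-a / t)) (Set.Ioi 0) := by
  have h := (integrableOn_Ioi_comp_rpow_iff (fun u : ℝ => Real.exp (-a * u ^ 2))
    (p := -1 / 2) (by norm_num)).2 (integrable_exp_neg_mul_sq ha).integrableOn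
  refine (h.const_mul 2).congr ?_
  filter_upwards [ae_restrict_mem measurableSet_Ioi] with t ht
  rw [gaussian_comp_rpow_neg_half ht]
  ring

theorem integral_inv_sqrt_cube_mul_exp_neg_div (a : ℝ) :
    ∫ t in Set.Ioi (0 : ℝ), (Real.sqrt t ^ 3)⁻¹ * Real.exp (-a / t) = Real.sqrt (Real.pi / a) := by
  have h := integral_comp_rpow_Ioi (fun u : ℝ => Real.exp (-a * u ^ 2))
    (p := -1 / 2) (by norm_num)
  rw [setIntegral_congr_fun measurableSet_Ioi (fun t ht => gaussian_comp_rpow_neg_half ht),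
    integral_gaussian_Ioi, integral_const_mul] at h
  linarith

theorem exp_mul_exp_complete_square {a b : ℝ} (hab : a + b ≠ 0) (x y : ℝ) :
    Real.exp (-a * y ^ 2) * Real.exp (-b * (x - y) ^ 2)
      = Real.exp (-(a * b / (a + b)) * x ^ 2) *
        Real.exp (-(a + b) * (y - b * x / (a + b)) ^ 2) := by
  rw [← Real.exp_add, ← Real.exp_add]
  congr 1
  field_simp
  ring

theorem integrable_gaussian_mul_gaussian_sub {a b : ℝ} (hab : 0 < a + b) (x : ℝ) :
    Integrable fun y : ℝ => Real.exp (-a * y ^ 2) * Real.exp (-b * (x - y) ^ 2) := by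
  simp_rw [exp_mul_exp_complete_square hab.ne']
  exact ((integrable_exp_neg_mul_sq hab).comp_sub_right _).const_mul _

theorem integral_gaussian_mul_gaussian_sub {a b : ℝ} (hab : a + b ≠ 0) (x : ℝ) :
    ∫ y : ℝ, Real.exp (-a * y ^ 2) * Real.exp (-b * (x - y) ^ 2)
      = Real.exp (-(a * b / (a + b)) * x ^ 2) * Real.sqrt (Real.pi / (a + b)) := by
  simp_rw [exp_mul_exp_complete_square hab]
  rw [integral_const_mul,
    integral_sub_right_eq_self (fun y : ℝ => Real.exp (-(a + b) * y ^ 2)), integral_gaussian]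

theorem integrable_euclidean_prod {ι : Type*} [Fintype ι] {f : ι → ℝ → ℝ}
    (hf : ∀ i, Integrable (f i)) :
    Integrable fun y : EuclideanSpace ℝ ι => ∏ i, f i (y i) :=
  ((EuclideanSpace.volume_preserving_symm_measurableEquiv_toLp ι).integrable_comp_emb
    (MeasurableEquiv.measurableEmbedding _)).2 (Integrable.fintype_prod hf)

theorem integral_euclidean_prod {ι : Type*} [Fintype ι] (f : ι → ℝ → ℝ) :
    ∫ y : EuclideanSpace ℝ ι, ∏ i, f i (y i) = ∏ i, ∫ u, f i u := by
  rw [← integral_fintype_prod_volume_eq_prod f]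
  exact (EuclideanSpace.volume_preserving_symm_measurableEquiv_toLp ι).integral_comp
    (MeasurableEquiv.measurableEmbedding _) fun v : ι → ℝ => ∏ i, f i (v i)

/-- The Coulomb kernel as a superposition of Gaussians. -/
theorem inv_four_pi_mul_eq_integral {σ r : ℝ} (hσ : 0 < σ) (hr : 0 ≤ r) :
    1 / (4 * Real.pi * r) = 1 / (4 * Real.sqrt Real.pi ^ 3 * σ) *
      ∫ t in Set.Ioi (0 : ℝ), (Real.sqrt t ^ 3)⁻¹ * Real.exp (-(r ^ 2 / σ ^ 2) / t) := by
  have hπ : 0 < Real.sqrt Real.pi := Real.sqrt_pos.2 Real.pi_pos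
  rw [integral_inv_sqrt_cube_mul_exp_neg_div, Real.sqrt_div Real.pi_pos.le, ← div_pow,
    Real.sqrt_sq (by positivity)]
  rcases hr.eq_or_lt with rfl | hr
  · simp
  nth_rewrite 1 [← Real.sq_sqrt Real.pi_pos.le]
  field_simp

theorem prod_gaussian_mul_gaussian_sub (σ γ t : ℝ) (x y : EuclideanSpace ℝ (Fin 3)) :
    ∏ i, Real.exp (-(![1 / σ ^ 2, 1 / σ ^ 2, γ ^ 2 / σ ^ 2] i) * y i ^ 2) *
        Real.exp (-(1 / (σ ^ 2 * t)) * (x i - y i) ^ 2)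
      = Real.exp (-(y 0 ^ 2 + y 1 ^ 2 + γ ^ 2 * y 2 ^ 2) / σ ^ 2) *
        Real.exp (-(‖x - y‖ ^ 2 / σ ^ 2) / t) := by
  rw [EuclideanSpace.norm_sq_eq]
  simp only [Fin.prod_univ_three, Fin.sum_univ_three, ← Real.exp_add, PiLp.sub_apply,
    Real.norm_eq_abs, sq_abs, Matrix.cons_val]
  congr 1
  ring

theorem prod_integral_gaussian_mul_gaussian_sub {σ γ t : ℝ} (hσ : 0 < σ) (hγ : 0 < γ) (ht : 0 < t)
    (x : EuclideanSpace ℝ (Fin 3)) :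
    1 / (4 * Real.sqrt Real.pi ^ 3 * σ) * ((Real.sqrt t ^ 3)⁻¹ *
      ∏ i, ∫ u : ℝ, Real.exp (-(![1 / σ ^ 2, 1 / σ ^ 2, γ ^ 2 / σ ^ 2] i) * u ^ 2) *
        Real.exp (-(1 / (σ ^ 2 * t)) * (x i - u) ^ 2))
      = σ ^ 2 / (4 * γ) * (Real.exp (-(x 0 ^ 2 + x 1 ^ 2) / (σ ^ 2 * (t + 1))) *
          Real.exp (-x 2 ^ 2 / (σ ^ 2 * (t + γ ^ (-2 : ℤ)))) /
            ((t + 1) * Real.sqrt (t + γ ^ (-2 : ℤ)))) := by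
  have hγ2 : γ ^ (-2 : ℤ) = (γ ^ 2)⁻¹ := by
    rw [zpow_neg]; norm_cast
  have hπ : 0 < Real.sqrt Real.pi := Real.sqrt_pos.2 Real.pi_pos
  have hst : 0 < Real.sqrt t := Real.sqrt_pos.2 ht
  have hA : Real.pi / (1 / σ ^ 2 + 1 / (σ ^ 2 * t)) = Real.pi * (σ ^ 2 * t / (t + 1)) := by
    field_simp
  have hB : Real.pi / (γ ^ 2 / σ ^ 2 + 1 / (σ ^ 2 * t))
      = (Real.sqrt Real.pi * σ * Real.sqrt t / γ) ^ 2 / (t + (γ ^ 2)⁻¹) := by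
    rw [div_pow, mul_pow, mul_pow, Real.sq_sqrt Real.pi_pos.le, Real.sq_sqrt ht.le]
    field_simp
  have hs : 0 < Real.sqrt (t + (γ ^ 2)⁻¹) := Real.sqrt_pos.2 (by positivity)
  have hAA : Real.sqrt (Real.pi * (σ ^ 2 * t / (t + 1))) *
      Real.sqrt (Real.pi * (σ ^ 2 * t / (t + 1)))
      = Real.sqrt Real.pi ^ 2 * σ ^ 2 * Real.sqrt t ^ 2 / (t + 1) := by
    rw [Real.mul_self_sqrt (by positivity), Real.sq_sqrt Real.pi_pos.le, Real.sq_sqrt ht.le]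
    ring
  have hBB : Real.sqrt ((Real.sqrt Real.pi * σ * Real.sqrt t / γ) ^ 2 / (t + (γ ^ 2)⁻¹))
      = Real.sqrt Real.pi * σ * Real.sqrt t / γ / Real.sqrt (t + (γ ^ 2)⁻¹) := by
    rw [Real.sqrt_div (by positivity), Real.sqrt_sq (by positivity)]
  have hE : Real.exp (-(1 / σ ^ 2 * (1 / (σ ^ 2 * t)) / (1 / σ ^ 2 + 1 / (σ ^ 2 * t))) * x 0 ^ 2) *
      Real.exp (-(1 / σ ^ 2 * (1 / (σ ^ 2 * t)) / (1 / σ ^ 2 + 1 / (σ ^ 2 * t))) * x 1 ^ 2)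
      = Real.exp (-(x 0 ^ 2 + x 1 ^ 2) / (σ ^ 2 * (t + 1))) := by
    rw [← Real.exp_add]
    congr 1
    field_simp
    ring
  have hE' : Real.exp
      (-(γ ^ 2 / σ ^ 2 * (1 / (σ ^ 2 * t)) / (γ ^ 2 / σ ^ 2 + 1 / (σ ^ 2 * t))) * x 2 ^ 2)
      = Real.exp (-x 2 ^ 2 / (σ ^ 2 * (t + (γ ^ 2)⁻¹))) := by
    congr 1
    field_simp
  simp only [Fin.prod_univ_three, Matrix.cons_val]
  rw [integral_gaussian_mul_gaussian_sub (by positivity),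
    integral_gaussian_mul_gaussian_sub (by positivity),
    integral_gaussian_mul_gaussian_sub (by positivity), hA, hB, hBB, hγ2, ← hE, ← hE',
    mul_mul_mul_comm (Real.exp _) _ (Real.exp _), hAA]
  field_simp

/-- The 3D Coulomb potential of the anisotropic Gaussian
`ρ(x) = e^{−(x₁² + x₂² + γ²x₃²)/σ²}`:
`∫ ρ(y)/(4π‖x−y‖) dy = (σ²/4γ) ∫_0^∞ e^{−(x₁²+x₂²)/(σ²(t+1))} e^{−x₃²/(σ²(t+γ⁻²))}
  / ((t+1)√(t+γ⁻²)) dt`. -/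
theorem coulomb3d_anisotropic_gaussian_potential (σ γ : ℝ) (hσ : 0 < σ) (hγ : 0 < γ)
    (hγ1 : γ ≠ 1) (x : EuclideanSpace ℝ (Fin 3)) :
    (∫ y : EuclideanSpace ℝ (Fin 3),
        Real.exp (-(y 0 ^ 2 + y 1 ^ 2 + γ ^ 2 * y 2 ^ 2) / σ ^ 2) /
          (4 * Real.pi * ‖x - y‖)) =
      (σ ^ 2 / (4 * γ)) * ∫ t in Set.Ioi (0 : ℝ),
        Real.exp (-(x 0 ^ 2 + x 1 ^ 2) / (σ ^ 2 * (t + 1))) *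
          Real.exp (-x 2 ^ 2 / (σ ^ 2 * (t + γ ^ (-2 : ℤ)))) /
            ((t + 1) * Real.sqrt (t + γ ^ (-2 : ℤ))) := by
  set a : Fin 3 → ℝ := ![1 / σ ^ 2, 1 / σ ^ 2, γ ^ 2 / σ ^ 2] with ha
  have ha0 : ∀ i, 0 < a i := by
    intro i
    fin_cases i <;> simp [ha] <;> positivity
  set P : EuclideanSpace ℝ (Fin 3) → ℝ → ℝ := fun y t => (Real.sqrt t ^ 3)⁻¹ *
    ∏ i, Real.exp (-(a i) * y i ^ 2) * Real.exp (-(1 / (σ ^ 2 * t)) * (x i - y i) ^ 2) with hP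
  have hPy : ∀ y, P y = fun t => Real.exp (-(y 0 ^ 2 + y 1 ^ 2 + γ ^ 2 * y 2 ^ 2) / σ ^ 2) *
      ((Real.sqrt t ^ 3)⁻¹ * Real.exp (-(‖x - y‖ ^ 2 / σ ^ 2) / t)) := by
    intro y
    funext t
    simp only [hP]
    rw [prod_gaussian_mul_gaussian_sub]
    ring
  have hswap : ∫ y, ∫ t in Set.Ioi (0 : ℝ), P y t = ∫ t in Set.Ioi (0 : ℝ), ∫ y, P y t := by
    refine integral_integral_swap_of_nonneg ?_ ?_ ?_ ?_
    · simp only [hP, Function.uncurry_def]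
      fun_prop
    · intro y t
      positivity
    · have hne : ∀ᵐ y : EuclideanSpace ℝ (Fin 3), y ≠ x := by
        simp [ae_iff]
      filter_upwards [hne] with y hy
      rw [hPy]
      have : 0 < ‖x - y‖ := norm_pos_iff.2 (sub_ne_zero.2 hy.symm)
      exact (integrableOn_inv_sqrt_cube_mul_exp_neg_div (by positivity)).const_mul _
    · filter_upwards [ae_restrict_mem measurableSet_Ioi] with t ht
      have ht : 0 < t := ht
      exact (integrable_euclidean_prod fun i => integrable_gaussian_mul_gaussian_sub
        (add_pos (ha0 i) (by positivity)) (x i)).const_mul _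
  calc
    _ = ∫ y, 1 / (4 * Real.sqrt Real.pi ^ 3 * σ) * ∫ t in Set.Ioi (0 : ℝ), P y t := by
      congr 1
      funext y
      rw [hPy, integral_const_mul, mul_left_comm,
        ← inv_four_pi_mul_eq_integral hσ (norm_nonneg _), mul_one_div]
    _ = _ := by
      rw [integral_const_mul, hswap, ← integral_const_mul, ← integral_const_mul]
      refine setIntegral_congr_fun measurableSet_Ioi fun t ht => ?_
      simp only [hP]
      rw [integral_const_mul, integral_euclidean_prod (fun i u =>
        Real.exp (-(a i) * u ^ 2) * Real.exp (-(1 / (σ ^ 2 * t)) * (x i - u) ^ 2))]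
      exact prod_integral_gaussian_mul_gaussian_sub hσ hγ ht x
end

section
/- Let σ > 0 and define ρ(x) = e^{−‖x‖²/σ²} on ℝ². Then for every x ∈ ℝ², the 2D Coulomb potential satisfies ∫_{ℝ²} ρ(y)/(2π‖x − y‖) dy = (√π σ/2) · I₀(‖x‖²/(2σ²)) · e^{−‖x‖²/(2σ²)}, where I₀ is the modified Bessel function of the first kind of order zero, given by I₀(z) = (1/π) ∫_0^π e^{z cos θ} dθ. -/
open MeasureTheory

/-- The modified Bessel function of the first kind of order zero,
`I₀(z) = (1/π) ∫_0^π e^{z cos θ} dθ`. -/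
noncomputable def besselI0 (z : ℝ) : ℝ :=
  (1 / Real.pi) * ∫ θ in (0 : ℝ)..Real.pi, Real.exp (z * Real.cos θ)

/-- The plane can be identified isometrically with `ℂ` so that a given point becomes its norm. -/
lemma exists_linearIsometryEquiv_complex_norm (x : EuclideanSpace ℝ (Fin 2)) :
    ∃ L : ℂ ≃ₗᵢ[ℝ] EuclideanSpace ℝ (Fin 2), L (‖x‖ : ℂ) = x := by
  let e := Complex.orthonormalBasisOneI.repr
  refine ⟨(rotation (Circle.exp (Complex.arg (e.symm x)))).trans e, ?_⟩
  have h : ‖x‖ = ‖e.symm x‖ := (e.symm.norm_map x).symm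
  have h2 : (rotation (Circle.exp (Complex.arg (e.symm x)))) (‖x‖ : ℂ) = e.symm x := by
    rw [rotation_apply, h, Circle.coe_exp, mul_comm]
    exact Complex.norm_mul_exp_arg_mul_I _
  rw [LinearIsometryEquiv.trans_apply, h2, e.apply_symm_apply]

/-- A line integral of a Gaussian centred off the line. -/
lemma integral_exp_neg_law_of_cosines (σ : ℝ) (hσ : 0 < σ) (R c : ℝ) :
    ∫ r : ℝ, Real.exp (-(r ^ 2 - 2 * r * R * c + R ^ 2) / σ ^ 2) =
      Real.sqrt Real.pi * σ * Real.exp (-(R ^ 2 * (1 - c ^ 2)) / σ ^ 2) := by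
  have h : ∀ r : ℝ, Real.exp (-(r ^ 2 - 2 * r * R * c + R ^ 2) / σ ^ 2) =
      Real.exp (-(R ^ 2 * (1 - c ^ 2)) / σ ^ 2) *
        Real.exp (-(1 / σ ^ 2) * (r - R * c) ^ 2) := fun r => by
    rw [← Real.exp_add]
    congr 1
    field_simp
    ring
  simp_rw [h]
  rw [integral_const_mul, integral_sub_right_eq_self (fun r => Real.exp (-(1 / σ ^ 2) * r ^ 2)),
    integral_gaussian, div_div_eq_mul_div, div_one, Real.sqrt_mul Real.pi_pos.le,
    Real.sqrt_sq hσ.le]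
  ring

lemma integrable_exp_neg_law_of_cosines (σ : ℝ) (hσ : 0 < σ) (R : ℝ) :
    Integrable (fun p : ℝ × ℝ =>
        Real.exp (-(p.1 ^ 2 - 2 * p.1 * R * Real.cos p.2 + R ^ 2) / σ ^ 2))
      ((volume : Measure ℝ).prod (volume.restrict (Set.Ioo (-Real.pi) Real.pi))) := by
  have h1 : Integrable (fun r : ℝ => Real.exp (-(1 / (2 * σ ^ 2)) * r ^ 2)) :=
    integrable_exp_neg_mul_sq (by positivity)
  have h2 : Integrable (fun _ : ℝ => Real.exp (R ^ 2 / σ ^ 2))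
      (volume.restrict (Set.Ioo (-Real.pi) Real.pi)) := integrable_const _
  refine (h1.mul_prod h2).mono' (by fun_prop) (Filter.Eventually.of_forall fun p => ?_)
  rw [Real.norm_eq_abs, Real.abs_exp, ← Real.exp_add, Real.exp_le_exp]
  have h3 : -(1 / (2 * σ ^ 2)) * p.1 ^ 2 + R ^ 2 / σ ^ 2 = (-p.1 ^ 2 / 2 + R ^ 2) / σ ^ 2 := by
    field_simp
  rw [h3]
  gcongr
  nlinarith [sq_nonneg (p.1 - 2 * R * Real.cos p.2), Real.cos_sq_le_one p.2,
    mul_le_mul_of_nonneg_left (Real.cos_sq_le_one p.2) (sq_nonneg R)]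

lemma integral_exp_mul_cos_sq (a : ℝ) :
    ∫ θ in (-Real.pi)..Real.pi, Real.exp (a * Real.cos θ ^ 2) =
      2 * Real.pi * Real.exp (a / 2) * besselI0 (a / 2) := by
  have hc : Continuous fun θ : ℝ => Real.exp (a / 2 * Real.cos θ) := by fun_prop
  have hper : Function.Periodic (fun θ : ℝ => Real.exp (a / 2 * Real.cos θ)) (2 * Real.pi) :=
    fun θ => by simp
  have h1 : ∀ θ : ℝ, Real.exp (a * Real.cos θ ^ 2) =
      Real.exp (a / 2) * Real.exp (a / 2 * Real.cos (2 * θ)) := fun θ => by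
    rw [← Real.exp_add, Real.cos_two_mul]
    congr 1
    ring
  have hneg : ∫ θ in (-Real.pi)..0, Real.exp (a / 2 * Real.cos θ) =
      ∫ θ in (0 : ℝ)..Real.pi, Real.exp (a / 2 * Real.cos θ) := by
    have := intervalIntegral.integral_comp_neg (a := 0) (b := Real.pi)
      (fun θ : ℝ => Real.exp (a / 2 * Real.cos θ))
    simpa using this.symm
  have hfull : ∫ θ in (-Real.pi)..Real.pi, Real.exp (a / 2 * Real.cos θ) =
      2 * ∫ θ in (0 : ℝ)..Real.pi, Real.exp (a / 2 * Real.cos θ) := by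
    rw [← intervalIntegral.integral_add_adjacent_intervals (hc.intervalIntegrable _ 0)
      (hc.intervalIntegrable 0 _), hneg, two_mul]
  have h_left : ∫ θ in (-(2 * Real.pi))..0, Real.exp (a / 2 * Real.cos θ) =
      ∫ θ in (-Real.pi)..Real.pi, Real.exp (a / 2 * Real.cos θ) := by
    have := hper.intervalIntegral_add_eq (-(2 * Real.pi)) (-Real.pi)
    convert this using 2 <;> ring
  have h_right : ∫ θ in (0 : ℝ)..(2 * Real.pi), Real.exp (a / 2 * Real.cos θ) =
      ∫ θ in (-Real.pi)..Real.pi, Real.exp (a / 2 * Real.cos θ) := by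
    have := hper.intervalIntegral_add_eq 0 (-Real.pi)
    convert this using 2 <;> ring
  have hdbl : ∫ θ in (-Real.pi)..Real.pi, Real.exp (a / 2 * Real.cos (2 * θ)) =
      ∫ θ in (-Real.pi)..Real.pi, Real.exp (a / 2 * Real.cos θ) := by
    rw [intervalIntegral.integral_comp_mul_left (fun θ => Real.exp (a / 2 * Real.cos θ))
      two_ne_zero, mul_neg, ← intervalIntegral.integral_add_adjacent_intervals
      (hc.intervalIntegrable _ 0) (hc.intervalIntegrable 0 _), h_left, h_right, smul_eq_mul]
    ring
  simp_rw [h1]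
  rw [intervalIntegral.integral_const_mul, hdbl, hfull, besselI0]
  field_simp

/-- The Coulomb integral in polar coordinates around the evaluation point. -/
lemma integral_polar_exp_neg_law_of_cosines (σ : ℝ) (hσ : 0 < σ) (R : ℝ) :
    ∫ p in Set.Ioi (0 : ℝ) ×ˢ Set.Ioo (-Real.pi) Real.pi,
        Real.exp (-(p.1 ^ 2 - 2 * p.1 * R * Real.cos p.2 + R ^ 2) / σ ^ 2) =
      Real.sqrt Real.pi * σ * Real.pi * besselI0 (R ^ 2 / (2 * σ ^ 2)) *
        Real.exp (-R ^ 2 / (2 * σ ^ 2)) := by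
  have hint := integrable_exp_neg_law_of_cosines σ hσ R
  have hpi : -Real.pi ≤ Real.pi := by linarith [Real.pi_pos]
  set f : ℝ → ℝ → ℝ := fun r θ =>
    Real.exp (-(r ^ 2 - 2 * r * R * Real.cos θ + R ^ 2) / σ ^ 2) with hf
  set G : ℝ → ℝ := fun r => ∫ θ in Set.Ioo (-Real.pi) Real.pi, f r θ
  have hGeven : ∀ r, G (-r) = G r := fun r => by
    have hper : Function.Periodic (f r) (2 * Real.pi) := fun θ => by simp [hf]
    have h1 : ∀ s, G s = ∫ θ in (-Real.pi)..Real.pi, f s θ := fun s => by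
      rw [intervalIntegral.integral_of_le hpi, integral_Ioc_eq_integral_Ioo]
    have h2 : ∀ θ, f (-r) θ = f r (θ + Real.pi) := fun θ => by simp [hf]
    rw [h1, h1]
    simp_rw [h2]
    rw [intervalIntegral.integral_comp_add_right]
    have := hper.intervalIntegral_add_eq 0 (-Real.pi)
    convert this using 2 <;> ring
  have hGabs : ∀ r, G |r| = G r := fun r => by
    rcases abs_choice r with h | h <;> rw [h]
    exact hGeven r
  have hhalf : ∫ r, G r = 2 * ∫ r in Set.Ioi (0 : ℝ), G r := by
    rw [← integral_comp_abs]
    simp_rw [hGabs]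
  have hswap : ∫ r, G r = ∫ θ in Set.Ioo (-Real.pi) Real.pi, ∫ r, f r θ :=
    integral_integral_swap hint
  have hset : ∫ p in Set.Ioi (0 : ℝ) ×ˢ Set.Ioo (-Real.pi) Real.pi, f p.1 p.2 =
      ∫ r in Set.Ioi (0 : ℝ), G r := by
    rw [Measure.volume_eq_prod]
    refine setIntegral_prod (fun p : ℝ × ℝ => f p.1 p.2) ?_
    rw [IntegrableOn, ← Measure.prod_restrict]
    have h := hint.integrableOn (s := Set.Ioi (0 : ℝ) ×ˢ Set.univ)
    rwa [IntegrableOn, ← Measure.prod_restrict, Measure.restrict_univ] at h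
  have hinner : ∀ θ, ∫ r, f r θ = Real.sqrt Real.pi * σ * Real.exp (-R ^ 2 / σ ^ 2) *
      Real.exp (R ^ 2 / σ ^ 2 * Real.cos θ ^ 2) := fun θ => by
    rw [integral_exp_neg_law_of_cosines σ hσ, mul_assoc (Real.sqrt Real.pi * σ),
      ← Real.exp_add]
    congr 2
    ring
  have hfin : ∫ r, G r = Real.sqrt Real.pi * σ * Real.exp (-R ^ 2 / σ ^ 2) *
      (2 * Real.pi * Real.exp (R ^ 2 / σ ^ 2 / 2) * besselI0 (R ^ 2 / σ ^ 2 / 2)) := by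
    rw [hswap]
    simp_rw [hinner]
    rw [integral_const_mul, ← integral_Ioc_eq_integral_Ioo,
      ← intervalIntegral.integral_of_le hpi, integral_exp_mul_cos_sq]
  have hexp : Real.exp (-R ^ 2 / (2 * σ ^ 2)) =
      Real.exp (-R ^ 2 / σ ^ 2) * Real.exp (R ^ 2 / σ ^ 2 / 2) := by
    rw [← Real.exp_add]
    congr 1
    field_simp
    ring
  have hz : R ^ 2 / (2 * σ ^ 2) = R ^ 2 / σ ^ 2 / 2 := by field_simp
  rw [hset, hexp, hz]
  linarith [hhalf, hfin]

/-- The 2D Coulomb potential of the Gaussian `ρ(x) = e^{−‖x‖²/σ²}`: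
`∫ ρ(y)/(2π‖x−y‖) dy = (√π σ/2) I₀(‖x‖²/(2σ²)) e^{−‖x‖²/(2σ²)}`. -/
theorem coulomb2d_gaussian_potential (σ : ℝ) (hσ : 0 < σ) (x : EuclideanSpace ℝ (Fin 2)) :
    (∫ y : EuclideanSpace ℝ (Fin 2),
        Real.exp (-‖y‖ ^ 2 / σ ^ 2) / (2 * Real.pi * ‖x - y‖)) =
      (Real.sqrt Real.pi * σ / 2) * besselI0 (‖x‖ ^ 2 / (2 * σ ^ 2)) *
        Real.exp (-‖x‖ ^ 2 / (2 * σ ^ 2)) := by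
  obtain ⟨L, hL⟩ := exists_linearIsometryEquiv_complex_norm x
  rw [← integral_sub_left_eq_self _ volume x]
  simp only [sub_sub_cancel]
  rw [← L.measurePreserving.integral_comp L.toHomeomorph.measurableEmbedding]
  have hnorm : ∀ z : ℂ, ‖x - L z‖ = ‖(‖x‖ : ℂ) - z‖ := fun z => by
    rw [← L.norm_map ((‖x‖ : ℂ) - z), map_sub, hL]
  simp only [hnorm, L.norm_map]
  rw [← Complex.integral_comp_polarCoord_symm, polarCoord_target]
  have hpt : ∀ p ∈ Set.Ioi (0 : ℝ) ×ˢ Set.Ioo (-Real.pi) Real.pi,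
      p.1 • (Real.exp (-‖(‖x‖ : ℂ) - Complex.polarCoord.symm p‖ ^ 2 / σ ^ 2) /
        (2 * Real.pi * ‖Complex.polarCoord.symm p‖)) =
      1 / (2 * Real.pi) *
        Real.exp (-(p.1 ^ 2 - 2 * p.1 * ‖x‖ * Real.cos p.2 + ‖x‖ ^ 2) / σ ^ 2) := by
    rintro ⟨r, θ⟩ ⟨hr, -⟩
    have hr : 0 < r := hr
    have hsq : ‖(‖x‖ : ℂ) - Complex.polarCoord.symm (r, θ)‖ ^ 2 =
        r ^ 2 - 2 * r * ‖x‖ * Real.cos θ + ‖x‖ ^ 2 := by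
      rw [Complex.sq_norm, Complex.normSq_apply, Complex.polarCoord_symm_apply]
      simp [-Complex.ofReal_cos, -Complex.ofReal_sin]
      linear_combination r ^ 2 * Real.sin_sq_add_cos_sq θ
    rw [Complex.norm_polarCoord_symm, hsq, abs_of_pos hr, smul_eq_mul]
    field_simp
  rw [setIntegral_congr_fun (measurableSet_Ioi.prod measurableSet_Ioo) hpt, integral_const_mul,
    integral_polar_exp_neg_law_of_cosines σ hσ]
  field_simp
end

section
/- Let σ > 0 and γ > 0 with γ ≠ 1, and define the anisotropic Gaussian density ρ(x) = e^{−(x₁² + γ² x₂²)/σ²} on ℝ². Then for every x = (x₁, x₂) ∈ ℝ², ∫_{ℝ²} ρ(y)/(2π‖x − y‖) dy = (σ/(γ√π)) ∫_0^∞ e^{−x₁²/(σ²(t² + 1))} · e^{−x₂²/(σ²(t² + γ^{−2}))} / (√(t² + 1) √(t² + γ^{−2})) dt. -/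
open MeasureTheory

theorem integral_exp_neg_sq_mul_exp_neg_sub_sq (a b x : ℝ) (h : 0 < a + b) :
    ∫ y : ℝ, Real.exp (-(a * y ^ 2)) * Real.exp (-(b * (x - y) ^ 2)) =
      Real.sqrt (Real.pi / (a + b)) * Real.exp (-(a * b / (a + b) * x ^ 2)) := by
  have key : ∀ y : ℝ, Real.exp (-(a * y ^ 2)) * Real.exp (-(b * (x - y) ^ 2)) =
      Real.exp (-(a + b) * (y - b * x / (a + b)) ^ 2) *
        Real.exp (-(a * b / (a + b) * x ^ 2)) := by
    intro y
    rw [← Real.exp_add, ← Real.exp_add]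
    congr 1
    field_simp
    ring
  simp_rw [key]
  rw [integral_mul_const,
    integral_sub_right_eq_self (fun y : ℝ => Real.exp (-(a + b) * y ^ 2)), integral_gaussian]

theorem EuclideanSpace.integral_fin_two_mul (f g : ℝ → ℝ) :
    ∫ y : EuclideanSpace ℝ (Fin 2), f (y 0) * g (y 1) = (∫ s, f s) * ∫ s, g s := by
  have h := (PiLp.volume_preserving_ofLp (Fin 2)).integral_comp
    (MeasurableEquiv.toLp 2 (Fin 2 → ℝ)).symm.measurableEmbedding
    (fun y : Fin 2 → ℝ => f (y 0) * g (y 1))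
  have hprod := integral_fintype_prod_volume_eq_prod (E := fun _ : Fin 2 => ℝ) ![f, g]
  simp only [Fin.prod_univ_two, Matrix.cons_val_zero, Matrix.cons_val_one] at hprod
  exact h.trans hprod

/-- A Gaussian superposition of the Coulomb kernel. -/
theorem integral_exp_neg_sq_div_sq_div_sq (σ r : ℝ) (hσ : 0 < σ) (hr : 0 < r) :
    ∫ t in Set.Ioi (0 : ℝ), Real.exp (-(r ^ 2 / (σ ^ 2 * t ^ 2))) / t ^ 2 =
      Real.sqrt Real.pi * σ / (2 * r) := by
  have h := integral_comp_rpow_Ioi (fun s : ℝ => Real.exp (-(r ^ 2 / σ ^ 2) * s ^ 2))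
    (p := -1) (by norm_num)
  rw [integral_gaussian_Ioi] at h
  have hs : Real.sqrt (Real.pi / (r ^ 2 / σ ^ 2)) = Real.sqrt Real.pi * σ / r := by
    rw [show Real.pi / (r ^ 2 / σ ^ 2) = Real.pi * (σ / r) ^ 2 by field_simp,
      Real.sqrt_mul Real.pi_pos.le, Real.sqrt_sq (by positivity)]
    ring
  rw [hs] at h
  rw [show Real.sqrt Real.pi * σ / (2 * r) = Real.sqrt Real.pi * σ / r / 2 by field_simp, ← h]
  refine setIntegral_congr_fun measurableSet_Ioi fun t ht => ?_
  have ht : 0 < t := ht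
  have h2 : t ^ (-1 - 1 : ℝ) = (t ^ 2)⁻¹ := by
    rw [show (-1 - 1 : ℝ) = -(2 : ℕ) by norm_num, Real.rpow_neg ht.le, Real.rpow_natCast]
  simp only [Real.rpow_neg_one, h2, abs_neg, abs_one, one_mul, smul_eq_mul]
  rw [div_eq_mul_inv, mul_comm]
  congr 2
  field_simp

theorem lintegral_ofReal_of_integral_ne_zero {α : Type*} [MeasurableSpace α] {μ : Measure α}
    {f : α → ℝ} (hf : 0 ≤ f) (h : ∫ a, f a ∂μ ≠ 0) :
    ∫⁻ a, ENNReal.ofReal (f a) ∂μ = ENNReal.ofReal (∫ a, f a ∂μ) :=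
  (ofReal_integral_eq_lintegral_ofReal (Integrable.of_integral_ne_zero h)
    (Filter.Eventually.of_forall hf)).symm

theorem integral_anisotropic_gaussian_mul_gaussian (σ γ t : ℝ) (hσ : 0 < σ) (hγ : 0 < γ)
    (ht : 0 < t) (x : EuclideanSpace ℝ (Fin 2)) :
    ∫ y : EuclideanSpace ℝ (Fin 2), Real.exp (-(y 0 ^ 2 + γ ^ 2 * y 1 ^ 2) / σ ^ 2) *
        (Real.exp (-(‖x - y‖ ^ 2 / (σ ^ 2 * t ^ 2))) / t ^ 2) =
      Real.pi * σ ^ 2 / γ * (Real.exp (-x 0 ^ 2 / (σ ^ 2 * (t ^ 2 + 1))) *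
          Real.exp (-x 1 ^ 2 / (σ ^ 2 * (t ^ 2 + γ ^ (-2 : ℤ)))) /
            (Real.sqrt (t ^ 2 + 1) * Real.sqrt (t ^ 2 + γ ^ (-2 : ℤ)))) := by
  have hz : γ ^ (-2 : ℤ) = (γ ^ 2)⁻¹ := by
    rw [zpow_neg]; norm_cast
  rw [hz]
  have key : ∀ y : EuclideanSpace ℝ (Fin 2),
      Real.exp (-(y 0 ^ 2 + γ ^ 2 * y 1 ^ 2) / σ ^ 2) *
        (Real.exp (-(‖x - y‖ ^ 2 / (σ ^ 2 * t ^ 2))) / t ^ 2) =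
      (Real.exp (-(1 / σ ^ 2 * y 0 ^ 2)) * Real.exp (-(1 / (σ ^ 2 * t ^ 2) * (x 0 - y 0) ^ 2))) *
      (Real.exp (-(γ ^ 2 / σ ^ 2 * y 1 ^ 2)) *
        Real.exp (-(1 / (σ ^ 2 * t ^ 2) * (x 1 - y 1) ^ 2))) * (t ^ 2)⁻¹ := by
    intro y
    rw [EuclideanSpace.norm_sq_eq, Fin.sum_univ_two, ← mul_div_assoc, div_eq_mul_inv _ (t ^ 2)]
    simp only [← Real.exp_add, PiLp.sub_apply, Real.norm_eq_abs, sq_abs]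
    congr 2
    field_simp
    ring
  simp_rw [key]
  rw [integral_mul_const, EuclideanSpace.integral_fin_two_mul
    (fun s => Real.exp (-(1 / σ ^ 2 * s ^ 2)) * Real.exp (-(1 / (σ ^ 2 * t ^ 2) * (x 0 - s) ^ 2)))
    (fun s => Real.exp (-(γ ^ 2 / σ ^ 2 * s ^ 2)) *
        Real.exp (-(1 / (σ ^ 2 * t ^ 2) * (x 1 - s) ^ 2))),
    integral_exp_neg_sq_mul_exp_neg_sub_sq _ _ _ (by positivity),
    integral_exp_neg_sq_mul_exp_neg_sub_sq _ _ _ (by positivity)]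
  have s1 : Real.sqrt (Real.pi / (1 / σ ^ 2 + 1 / (σ ^ 2 * t ^ 2))) =
      Real.sqrt Real.pi * (σ * t) / Real.sqrt (t ^ 2 + 1) := by
    rw [show Real.pi / (1 / σ ^ 2 + 1 / (σ ^ 2 * t ^ 2)) =
      Real.pi * (σ * t) ^ 2 / (t ^ 2 + 1) by field_simp, Real.sqrt_div (by positivity),
      Real.sqrt_mul Real.pi_pos.le, Real.sqrt_sq (by positivity)]
  have s2 : Real.sqrt (Real.pi / (γ ^ 2 / σ ^ 2 + 1 / (σ ^ 2 * t ^ 2))) =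
      Real.sqrt Real.pi * (σ * t / γ) / Real.sqrt (t ^ 2 + (γ ^ 2)⁻¹) := by
    rw [show Real.pi / (γ ^ 2 / σ ^ 2 + 1 / (σ ^ 2 * t ^ 2)) =
      Real.pi * (σ * t / γ) ^ 2 / (t ^ 2 + (γ ^ 2)⁻¹) by field_simp,
      Real.sqrt_div (by positivity),
      Real.sqrt_mul Real.pi_pos.le, Real.sqrt_sq (by positivity)]
  have e1 : -(1 / σ ^ 2 * (1 / (σ ^ 2 * t ^ 2)) / (1 / σ ^ 2 + 1 / (σ ^ 2 * t ^ 2)) * x 0 ^ 2) =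
      -x 0 ^ 2 / (σ ^ 2 * (t ^ 2 + 1)) := by
    field_simp
  have e2 : -(γ ^ 2 / σ ^ 2 * (1 / (σ ^ 2 * t ^ 2)) /
      (γ ^ 2 / σ ^ 2 + 1 / (σ ^ 2 * t ^ 2)) * x 1 ^ 2) =
      -x 1 ^ 2 / (σ ^ 2 * (t ^ 2 + (γ ^ 2)⁻¹)) := by
    field_simp
  rw [s1, s2, e1, e2]
  have hp : Real.pi = Real.sqrt Real.pi * Real.sqrt Real.pi :=
    (Real.mul_self_sqrt Real.pi_pos.le).symm
  have q1 : 0 < Real.sqrt (t ^ 2 + 1) := by positivity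
  have q2 : 0 < Real.sqrt (t ^ 2 + (γ ^ 2)⁻¹) := by positivity
  generalize Real.sqrt (t ^ 2 + 1) = A at *
  generalize Real.sqrt (t ^ 2 + (γ ^ 2)⁻¹) = B at *
  generalize Real.exp _ = E
  generalize Real.exp _ = F
  rw [hp, Real.sqrt_mul_self (Real.sqrt_nonneg _)]
  field_simp

/-- The 2D Coulomb potential of the anisotropic Gaussian `ρ(x) = e^{−(x₁² + γ²x₂²)/σ²}`:
`∫ ρ(y)/(2π‖x−y‖) dy = (σ/(γ√π)) ∫_0^∞ e^{−x₁²/(σ²(t²+1))} e^{−x₂²/(σ²(t²+γ⁻²))}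
  / (√(t²+1)√(t²+γ⁻²)) dt`. -/
theorem coulomb2d_anisotropic_gaussian_potential (σ γ : ℝ) (hσ : 0 < σ) (hγ : 0 < γ)
    (hγ1 : γ ≠ 1) (x : EuclideanSpace ℝ (Fin 2)) :
    (∫ y : EuclideanSpace ℝ (Fin 2),
        Real.exp (-(y 0 ^ 2 + γ ^ 2 * y 1 ^ 2) / σ ^ 2) / (2 * Real.pi * ‖x - y‖)) =
      (σ / (γ * Real.sqrt Real.pi)) * ∫ t in Set.Ioi (0 : ℝ),
        Real.exp (-x 0 ^ 2 / (σ ^ 2 * (t ^ 2 + 1))) *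
          Real.exp (-x 1 ^ 2 / (σ ^ 2 * (t ^ 2 + γ ^ (-2 : ℤ)))) /
            (Real.sqrt (t ^ 2 + 1) * Real.sqrt (t ^ 2 + γ ^ (-2 : ℤ))) := by
  set c : ℝ := 1 / (Real.pi * Real.sqrt Real.pi * σ) with hc
  have hcpos : 0 < c := by positivity
  set ρ : EuclideanSpace ℝ (Fin 2) → ℝ :=
    fun y => Real.exp (-(y 0 ^ 2 + γ ^ 2 * y 1 ^ 2) / σ ^ 2)
  set k : EuclideanSpace ℝ (Fin 2) → ℝ → ℝ :=
    fun y t => Real.exp (-(‖x - y‖ ^ 2 / (σ ^ 2 * t ^ 2))) / t ^ 2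
  have hρm : Measurable ρ := by fun_prop
  have hkm : Measurable fun p : EuclideanSpace ℝ (Fin 2) × ℝ => c * (ρ p.1 * k p.1 p.2) := by
    fun_prop
  have hρ : ∀ y, 0 < ρ y := fun y => Real.exp_pos _
  have hk : ∀ y t, 0 ≤ k y t := fun y t => by positivity
  have inner_t : ∀ᵐ y : EuclideanSpace ℝ (Fin 2), ENNReal.ofReal (ρ y / (2 * Real.pi * ‖x - y‖)) =
      ∫⁻ t in Set.Ioi (0 : ℝ), ENNReal.ofReal (c * (ρ y * k y t)) := by
    filter_upwards [Measure.ae_ne volume x] with y hy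
    have hr : 0 < ‖x - y‖ := norm_pos_iff.2 (sub_ne_zero.2 hy.symm)
    have hval : ∫ t in Set.Ioi (0 : ℝ), c * (ρ y * k y t) = ρ y / (2 * Real.pi * ‖x - y‖) := by
      rw [integral_const_mul, integral_const_mul,
        integral_exp_neg_sq_div_sq_div_sq σ _ hσ hr, hc]
      field_simp
    have := hρ y
    rw [lintegral_ofReal_of_integral_ne_zero
      (fun t => mul_nonneg hcpos.le (mul_nonneg (hρ y).le (hk y t))) (by rw [hval]; positivity),
      hval]
  rw [integral_eq_lintegral_of_nonneg_ae
      (Filter.Eventually.of_forall fun y => by have := hρ y; positivity)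
      (by fun_prop : Measurable fun y => ρ y / (2 * Real.pi * ‖x - y‖)).aestronglyMeasurable,
    lintegral_congr_ae inner_t, lintegral_lintegral_swap hkm.ennreal_ofReal.aemeasurable,
    ← integral_const_mul, integral_eq_lintegral_of_nonneg_ae
      (Filter.Eventually.of_forall fun t => by positivity)
      (by fun_prop : Measurable _).aestronglyMeasurable]
  congr 1
  refine setLIntegral_congr_fun measurableSet_Ioi fun t ht => ?_
  have ht : 0 < t := ht
  have hval := integral_anisotropic_gaussian_mul_gaussian σ γ t hσ hγ ht x
  change ∫ y, ρ y * k y t = _ at hval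
  simp only
  rw [lintegral_ofReal_of_integral_ne_zero
    (fun y => mul_nonneg hcpos.le (mul_nonneg (hρ y).le (hk y t)))
    (by rw [integral_const_mul, hval]; positivity), integral_const_mul, hval, hc, ← mul_assoc]
  congr 2
  field_simp
end

section
/- Let σ > 0 and define ρ(x) = e^{−‖x‖²/σ²} on ℝ². Then for every x ∈ ℝ² with x ≠ 0, the 2D Poisson potential satisfies −(1/(2π)) ∫_{ℝ²} ρ(y) ln‖x − y‖ dy = −(σ²/4) [E₁(‖x‖²/σ²) + 2 ln‖x‖], where E₁(r) = ∫_r^∞ t^{−1} e^{−t} dt is the exponential integral function. -/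
open MeasureTheory

/-- The exponential integral function `E₁(r) = ∫_r^∞ t⁻¹ e^{−t} dt`. -/
noncomputable def expIntE1 (r : ℝ) : ℝ := ∫ t in Set.Ioi r, Real.exp (-t) / t

open Real Set Filter Topology

lemma abs_mul_log_le_one_add_sq {r : ℝ} (hr : 0 < r) : |r * log r| ≤ 1 + r ^ 2 := by
  have h1 := log_le_sub_one_of_pos hr
  have h2 := one_sub_inv_le_log_of_pos hr
  have h3 : r * (1 - r⁻¹) = r - 1 := by field_simp
  have h4 := mul_le_mul_of_nonneg_left h2 hr.le
  have h5 := mul_le_mul_of_nonneg_left h1 hr.le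
  rw [abs_le]
  constructor <;> nlinarith [sq_nonneg r]

lemma integrableOn_mul_exp_neg_mul_sq_mul_log {b : ℝ} (hb : 0 < b) :
    IntegrableOn (fun r : ℝ => r * exp (-b * r ^ 2) * log r) (Ioi 0) := by
  have h0 := (integrable_exp_neg_mul_sq hb).integrableOn (s := Ioi 0)
  have h2 := (integrable_rpow_mul_exp_neg_mul_sq hb (s := 2) (by norm_num)).integrableOn
    (s := Ioi 0)
  refine (h0.add h2).mono' (by fun_prop) ?_
  filter_upwards [ae_restrict_mem measurableSet_Ioi] with r hr
  have h := abs_mul_log_le_one_add_sq hr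
  rw [norm_eq_abs, mul_right_comm, abs_mul, abs_of_pos (exp_pos _)]
  simp only [Pi.add_apply, rpow_two]
  nlinarith [exp_pos (-b * r ^ 2)]

lemma integrableOn_exp_neg_div {a : ℝ} (ha : 0 < a) :
    IntegrableOn (fun t => exp (-t) / t) (Ioi a) := by
  refine ((integrableOn_exp_neg_Ioi a).const_mul a⁻¹).mono'
    (Measurable.aestronglyMeasurable (by fun_prop)) ?_
  filter_upwards [ae_restrict_mem measurableSet_Ioi] with t ht
  have ht' : a < t := ht
  rw [norm_eq_abs, abs_of_pos (div_pos (exp_pos _) (ha.trans ht')), div_eq_inv_mul]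
  gcongr

lemma hasDerivAt_expIntE1 {r : ℝ} (hr : 0 < r) :
    HasDerivAt expIntE1 (-(exp (-r) / r)) r := by
  have hc : ContinuousAt (fun t => exp (-t) / t) r := by
    fun_prop (disch := exact hr.ne')
  have h : HasDerivAt (fun u => ∫ t in r..u, exp (-t) / t) (exp (-r) / r) r :=
    intervalIntegral.integral_hasDerivAt_right (by simp)
      (Measurable.stronglyMeasurable (by fun_prop)).stronglyMeasurableAtFilter hc
  refine (h.const_sub (expIntE1 r)).congr_of_eventuallyEq ?_
  filter_upwards [lt_mem_nhds hr] with u hu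
  rw [expIntE1, expIntE1, ← intervalIntegral.integral_Ioi_sub_Ioi' (integrableOn_exp_neg_div hr)
    (integrableOn_exp_neg_div hu), sub_sub_cancel]

lemma tendsto_expIntE1_atTop : Tendsto expIntE1 atTop (𝓝 0) := by
  have h := (intervalIntegral_tendsto_integral_Ioi 1 (integrableOn_exp_neg_div one_pos)
    tendsto_id).const_sub (expIntE1 1)
  rw [← expIntE1, sub_self] at h
  refine h.congr' ?_
  filter_upwards [eventually_gt_atTop 0] with u hu
  rw [expIntE1, expIntE1, id, ← intervalIntegral.integral_Ioi_sub_Ioi'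
    (integrableOn_exp_neg_div one_pos) (integrableOn_exp_neg_div hu), sub_sub_cancel]

lemma tendsto_exp_neg_mul_sq_mul_log_atTop {b : ℝ} (hb : 0 < b) :
    Tendsto (fun r => exp (-b * r ^ 2) * log r) atTop (𝓝 0) := by
  have h : Tendsto (fun r : ℝ => b⁻¹ * r⁻¹) atTop (𝓝 0) := by
    simpa using tendsto_inv_atTop_zero.const_mul b⁻¹
  refine squeeze_zero' ?_ ?_ h
  · filter_upwards [eventually_ge_atTop 1] with r hr
    exact mul_nonneg (exp_pos _).le (log_nonneg hr)
  · filter_upwards [eventually_ge_atTop 1] with r hr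
    have hr0 : 0 < r := by linarith
    have h1 : exp (-b * r ^ 2) ≤ (b * r ^ 2)⁻¹ := by
      rw [neg_mul, exp_neg]
      exact inv_anti₀ (by positivity) (by linarith [add_one_le_exp (b * r ^ 2)])
    calc exp (-b * r ^ 2) * log r ≤ (b * r ^ 2)⁻¹ * r :=
          mul_le_mul h1 (by linarith [log_le_sub_one_of_pos hr0]) (log_nonneg hr)
            (by positivity)
      _ = b⁻¹ * r⁻¹ := by field_simp

lemma hasDerivAt_exp_neg_mul_sq (b r : ℝ) :
    HasDerivAt (fun r => exp (-b * r ^ 2)) (exp (-b * r ^ 2) * (-b * (2 * r))) r := by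
  simpa using ((hasDerivAt_pow 2 r).const_mul (-b)).exp

lemma integral_Ioi_mul_exp_neg_mul_sq_mul_log {b R : ℝ} (hb : 0 < b) (hR : 0 < R) :
    ∫ r in Ioi R, r * exp (-b * r ^ 2) * log r =
      (2 * b)⁻¹ * (exp (-b * R ^ 2) * log R) + (4 * b)⁻¹ * expIntE1 (b * R ^ 2) := by
  have hderiv : ∀ r ∈ Ici R, HasDerivAt
      (fun r => -(2 * b)⁻¹ * (exp (-b * r ^ 2) * log r) + -(4 * b)⁻¹ * expIntE1 (b * r ^ 2))
      (r * exp (-b * r ^ 2) * log r) r := by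
    intro r hr
    have hr0 : 0 < r := hR.trans_le hr
    have h1 := ((hasDerivAt_exp_neg_mul_sq b r).mul (hasDerivAt_log hr0.ne')).const_mul
      (-(2 * b)⁻¹)
    have h2 := ((hasDerivAt_expIntE1 (by positivity : 0 < b * r ^ 2)).comp r
      ((hasDerivAt_pow 2 r).const_mul b)).const_mul (-(4 * b)⁻¹)
    refine (h1.add h2).congr_deriv ?_
    rw [neg_mul b]
    push_cast
    field_simp
    ring
  have hlim : Tendsto
      (fun r => -(2 * b)⁻¹ * (exp (-b * r ^ 2) * log r) + -(4 * b)⁻¹ * expIntE1 (b * r ^ 2))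
      atTop (𝓝 0) := by
    have h1 := (tendsto_exp_neg_mul_sq_mul_log_atTop hb).const_mul (-(2 * b)⁻¹)
    have h2 := (tendsto_expIntE1_atTop.comp
      ((tendsto_pow_atTop two_ne_zero).const_mul_atTop hb)).const_mul (-(4 * b)⁻¹)
    simpa using h1.add h2
  rw [integral_Ioi_of_hasDerivAt_of_tendsto' hderiv
    ((integrableOn_mul_exp_neg_mul_sq_mul_log hb).mono_set (Ioi_subset_Ioi hR.le)) hlim]
  ring

lemma integral_mul_exp_neg_mul_sq_mul_log_max {b R : ℝ} (hb : 0 < b) (hR : 0 < R) :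
    ∫ r in Ioi 0, r * exp (-b * r ^ 2) * log (max r R) =
      (4 * b)⁻¹ * (expIntE1 (b * R ^ 2) + 2 * log R) := by
  have hin : ∫ r in (0 : ℝ)..R, r * exp (-b * r ^ 2) * log (max r R) =
      (2 * b)⁻¹ * (1 - exp (-b * R ^ 2)) * log R := by
    have h1 : ∫ r in (0 : ℝ)..R, r * exp (-b * r ^ 2) * log (max r R) =
        ∫ r in (0 : ℝ)..R, r * exp (-b * r ^ 2) * log R := by
      refine intervalIntegral.integral_congr fun r hr => ?_
      rw [uIcc_of_le hR.le] at hr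
      simp only [max_eq_right hr.2]
    have h2 : ∫ r in (0 : ℝ)..R, r * exp (-b * r ^ 2) =
        -(2 * b)⁻¹ * exp (-b * R ^ 2) - -(2 * b)⁻¹ * exp (-b * 0 ^ 2) := by
      refine intervalIntegral.integral_eq_sub_of_hasDerivAt (f := fun r => -(2 * b)⁻¹ * exp (-b * r ^ 2))
        (fun r _ => ?_) (Continuous.intervalIntegrable (by fun_prop) _ _)
      refine ((hasDerivAt_exp_neg_mul_sq b r).const_mul (-(2 * b)⁻¹)).congr_deriv ?_
      field_simp
    rw [h1, intervalIntegral.integral_mul_const, h2, zero_pow two_ne_zero, mul_zero, exp_zero]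
    ring
  have hout : EqOn (fun r => r * exp (-b * r ^ 2) * log r)
      (fun r => r * exp (-b * r ^ 2) * log (max r R)) (Ioi R) := by
    intro r hr
    simp only [max_eq_left (le_of_lt (mem_Ioi.1 hr))]
  have hint : IntervalIntegrable (fun r => r * exp (-b * r ^ 2) * log (max r R)) volume 0 R := by
    refine Continuous.intervalIntegrable ?_ _ _
    have : Continuous fun r => log (max r R) :=
      (continuous_id.max continuous_const).log fun r => (hR.trans_le (le_max_right _ _)).ne'
    fun_prop
  rw [← intervalIntegral.integral_interval_add_Ioi' hint
      (((integrableOn_mul_exp_neg_mul_sq_mul_log hb).mono_set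
        (Ioi_subset_Ioi hR.le)).congr_fun hout measurableSet_Ioi),
    hin, ← setIntegral_congr_fun measurableSet_Ioi hout,
    integral_Ioi_mul_exp_neg_mul_sq_mul_log hb hR]
  field_simp
  ring

lemma integral_log_norm_polarCoord_symm_sub {r : ℝ} (hr : 0 < r) {a : ℂ} (ha : a ≠ 0) :
    ∫ θ in Ioo (-π) π, log ‖Complex.polarCoord.symm (r, θ) - a‖ =
      2 * π * log (max r ‖a‖) := by
  have hcirc := circleAverage_log_norm_sub_const_eq_log_radius_add_posLog (c := 0) (a := a) hr.ne'
  have hlog : log r + log⁺ (r⁻¹ * ‖(0 : ℂ) - a‖) = log (max r ‖a‖) := by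
    have ha' := norm_pos_iff.2 ha
    rw [zero_sub, norm_neg]
    rcases le_total r ‖a‖ with h | h
    · rw [max_eq_right h, posLog_eq_log, log_mul (by positivity) (by positivity), log_inv]
      · ring
      · rw [abs_of_pos (by positivity), ← div_eq_inv_mul]
        exact (one_le_div hr).2 h
    · rw [max_eq_left h, posLog_eq_zero_iff _ |>.2, add_zero]
      rw [abs_of_pos (by positivity), ← div_eq_inv_mul]
      exact (div_le_one hr).2 h
  rw [hlog, circleAverage_eq_integral_add (-π),
    intervalIntegral.integral_comp_add_right (fun θ => log ‖circleMap 0 r θ - a‖)] at hcirc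
  rw [← hcirc, smul_eq_mul, mul_inv_cancel_left₀ two_pi_pos.ne', zero_add,
    show 2 * π + -π = π by ring, intervalIntegral.integral_of_le (by linarith [pi_pos]),
    integral_Ioc_eq_integral_Ioo]
  simp [circleMap, Complex.exp_mul_I]

lemma integrable_exp_neg_mul_norm_sq_mul_log_norm_sub {b : ℝ} (hb : 0 < b) (a : ℂ) :
    Integrable fun z : ℂ => exp (-b * ‖z‖ ^ 2) * log ‖z - a‖ := by
  have hrad : Integrable fun z : ℂ => exp (-(b / 2) * ‖z‖ ^ 2) * log ‖z‖ := by
    refine (integrable_fun_norm_addHaar (volume : Measure ℂ)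
      (f := fun r => exp (-(b / 2) * r ^ 2) * log r)).2 ?_
    simpa [Complex.finrank_real_complex, mul_assoc] using
      integrableOn_mul_exp_neg_mul_sq_mul_log (half_pos hb)
  have hmaj := (hrad.norm.const_mul (exp (b * ‖a‖ ^ 2))).comp_sub_right a
  refine hmaj.mono' (Measurable.aestronglyMeasurable (by fun_prop)) (ae_of_all _ fun z => ?_)
  rw [norm_mul, norm_mul, ← mul_assoc, norm_of_nonneg (exp_pos _).le,
    norm_of_nonneg (exp_pos _).le, ← exp_add]
  gcongr
  have h : ‖z - a‖ ^ 2 ≤ (‖z‖ + ‖a‖) ^ 2 := by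
    gcongr
    exact norm_sub_le z a
  nlinarith [mul_nonneg hb.le (sq_nonneg (‖z‖ - ‖a‖)), mul_le_mul_of_nonneg_left h hb.le]

lemma integrableOn_polarCoord_target_of_integrable {f : ℂ → ℝ} (hf : Integrable f)
    (hm : Measurable f) :
    IntegrableOn (fun p : ℝ × ℝ => p.1 * f (Complex.polarCoord.symm p)) polarCoord.target := by
  have hs : Measurable fun p : ℝ × ℝ => Complex.polarCoord.symm p := by
    simp only [Complex.polarCoord_symm_apply]
    fun_prop
  refine ⟨(measurable_fst.mul (hm.comp hs)).aestronglyMeasurable, ?_⟩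
  have h := hf.2
  rw [hasFiniteIntegral_iff_enorm, ← Complex.lintegral_comp_polarCoord_symm] at h
  rw [hasFiniteIntegral_iff_enorm]
  refine (setLIntegral_congr_fun polarCoord.open_target.measurableSet fun p hp => ?_).trans_lt h
  simp only [smul_eq_mul, enorm_mul, Real.enorm_of_nonneg (le_of_lt (mem_Ioi.1 hp.1))]

lemma integral_exp_neg_mul_norm_sq_mul_log_norm_sub {b : ℝ} (hb : 0 < b) {a : ℂ} (ha : a ≠ 0) :
    ∫ z : ℂ, exp (-b * ‖z‖ ^ 2) * log ‖z - a‖ =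
      2 * π * ((4 * b)⁻¹ * (expIntE1 (b * ‖a‖ ^ 2) + 2 * log ‖a‖)) := by
  have hint := integrableOn_polarCoord_target_of_integrable
    (integrable_exp_neg_mul_norm_sq_mul_log_norm_sub hb a) (by fun_prop)
  rw [← Complex.integral_comp_polarCoord_symm]
  simp only [smul_eq_mul]
  rw [polarCoord_target] at hint ⊢
  rw [Measure.volume_eq_prod, setIntegral_prod _ hint,
    ← integral_mul_exp_neg_mul_sq_mul_log_max hb (norm_pos_iff.2 ha), ← integral_const_mul]
  refine setIntegral_congr_fun measurableSet_Ioi fun r hr => ?_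
  simp only [Complex.norm_polarCoord_symm, sq_abs, ← mul_assoc]
  rw [integral_const_mul, integral_log_norm_polarCoord_symm_sub hr ha]
  ring

/-- The 2D Poisson potential of the Gaussian `ρ(x) = e^{−‖x‖²/σ²}`: for `x ≠ 0`,
`−(1/2π) ∫ ρ(y) ln‖x−y‖ dy = −(σ²/4)[E₁(‖x‖²/σ²) + 2 ln‖x‖]`. -/
theorem poisson2d_gaussian_potential (σ : ℝ) (hσ : 0 < σ)
    (x : EuclideanSpace ℝ (Fin 2)) (hx : x ≠ 0) :
    -(1 / (2 * Real.pi)) * (∫ y : EuclideanSpace ℝ (Fin 2),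
        Real.exp (-‖y‖ ^ 2 / σ ^ 2) * Real.log ‖x - y‖) =
      -(σ ^ 2 / 4) * (expIntE1 (‖x‖ ^ 2 / σ ^ 2) + 2 * Real.log ‖x‖) := by
  have hb : 0 < 1 / σ ^ 2 := by positivity
  let e := Complex.orthonormalBasisOneI.repr
  have ha : e.symm x ≠ 0 := by simpa using hx
  have h := integral_exp_neg_mul_norm_sq_mul_log_norm_sub hb ha
  have hcomp : ∫ y : EuclideanSpace ℝ (Fin 2), Real.exp (-‖y‖ ^ 2 / σ ^ 2) * Real.log ‖x - y‖ =
      ∫ z : ℂ, Real.exp (-(1 / σ ^ 2) * ‖z‖ ^ 2) * Real.log ‖z - e.symm x‖ := by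
    rw [← e.measurePreserving.integral_comp e.toHomeomorph.measurableEmbedding]
    congr 1 with z
    have hz : ‖x - e z‖ = ‖z - e.symm x‖ := by
      rw [norm_sub_rev, ← e.norm_map (z - e.symm x), map_sub, e.apply_symm_apply]
    rw [hz, e.norm_map]
    congr 2
    ring
  rw [hcomp, h, e.symm.norm_map, one_div_mul_eq_div]
  have := Real.pi_pos.ne'
  field_simp
end

section
/- Let σ > 0. Then −(1/(2π)) ∫_{ℝ²} e^{−‖y‖²/σ²} ln‖y‖ dy = (σ²/4)(γ_e − ln(σ²)), where γ_e is the Euler–Mascheroni constant; i.e., the 2D Poisson potential of the Gaussian density ρ(x) = e^{−‖x‖²/σ²} evaluated at the origin equals (σ²/4)(γ_e − ln σ²). -/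
open MeasureTheory

open Set in
/-- The logarithmic moment of the standard exponential distribution is `-γ`. -/
lemma integral_exp_neg_mul_log_Ioi :
    ∫ t in Ioi (0 : ℝ), Real.exp (-t) * Real.log t = -Real.eulerMascheroniConstant := by
  have hGamma : Complex.Gamma =ᶠ[nhds 1] Complex.GammaIntegral := by
    filter_upwards [(isOpen_lt continuous_const Complex.continuous_re).mem_nhds
      (show (0 : ℝ) < (1 : ℂ).re by simp)] with s hs
    exact Complex.Gamma_eq_integral hs
  have hderiv := ((Complex.hasDerivAt_GammaIntegral (s := 1) (by simp)).congr_of_eventuallyEq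
    hGamma).unique Complex.hasDerivAt_Gamma_one
  have hcast : (∫ t : ℝ in Ioi 0, (t : ℂ) ^ ((1 : ℂ) - 1) * (Real.log t * Real.exp (-t))) =
      ((∫ t in Ioi (0 : ℝ), Real.exp (-t) * Real.log t : ℝ) : ℂ) := by
    rw [← integral_complex_ofReal]
    congr 1 with t
    simp [mul_comm]
  rw [hcast] at hderiv
  exact_mod_cast hderiv

open Set in
lemma integrableOn_exp_neg_mul_log_Ioi :
    IntegrableOn (fun t : ℝ => Real.exp (-t) * Real.log t) (Ioi 0) := by
  apply Integrable.of_integral_ne_zero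
  rw [integral_exp_neg_mul_log_Ioi]
  linarith [Real.one_half_lt_eulerMascheroniConstant]

open Set in
lemma integral_exp_neg_div_mul_log_Ioi {c : ℝ} (hc : 0 < c) :
    ∫ u in Ioi (0 : ℝ), Real.exp (-u / c) * Real.log u =
      c * (Real.log c - Real.eulerMascheroniConstant) := by
  have hscale := integral_comp_mul_left_Ioi'
    (fun u : ℝ => Real.exp (-u / c) * Real.log u) 0 hc
  rw [mul_zero] at hscale
  rw [← hscale, smul_eq_mul]
  congr 1
  have hsplit : ∀ t ∈ Ioi (0 : ℝ), Real.exp (-(c * t) / c) * Real.log (c * t) =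
      Real.exp (-t) * Real.log c + Real.exp (-t) * Real.log t := by
    intro t ht
    rw [Real.log_mul hc.ne' (ne_of_gt ht), neg_div, mul_div_cancel_left₀ _ hc.ne', mul_add]
  rw [setIntegral_congr_fun measurableSet_Ioi hsplit,
    integral_add ((integrableOn_exp_neg_Ioi 0).mul_const _) integrableOn_exp_neg_mul_log_Ioi,
    integral_mul_const, integral_exp_neg_Ioi_zero, integral_exp_neg_mul_log_Ioi]
  ring

open Set in
lemma integral_mul_exp_neg_sq_div_mul_log_Ioi {c : ℝ} (hc : 0 < c) :
    ∫ r in Ioi (0 : ℝ), r * (Real.exp (-r ^ 2 / c) * Real.log r) =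
      c / 4 * (Real.log c - Real.eulerMascheroniConstant) := by
  have hsq := integral_comp_rpow_Ioi_of_pos
    (g := fun u : ℝ => Real.exp (-u / c) * Real.log u) two_pos
  rw [integral_exp_neg_div_mul_log_Ioi hc] at hsq
  have hrad : ∀ r ∈ Ioi (0 : ℝ), ((2 : ℝ) * r ^ ((2 : ℝ) - 1)) •
      (Real.exp (-(r ^ (2 : ℝ)) / c) * Real.log (r ^ (2 : ℝ))) =
      4 * (r * (Real.exp (-r ^ 2 / c) * Real.log r)) := by
    intro r hr
    rw [Real.log_rpow hr, Real.rpow_two, show (2 : ℝ) - 1 = 1 by norm_num, Real.rpow_one,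
      smul_eq_mul]
    ring
  rw [setIntegral_congr_fun measurableSet_Ioi hrad, integral_const_mul] at hsq
  linarith

/-- The 2D Poisson potential of the Gaussian `ρ(x) = e^{−‖x‖²/σ²}` at the origin:
`−(1/2π) ∫ e^{−‖y‖²/σ²} ln‖y‖ dy = (σ²/4)(γ_e − ln σ²)` with `γ_e` the
Euler–Mascheroni constant. -/
theorem poisson2d_gaussian_potential_at_origin (σ : ℝ) (hσ : 0 < σ) :
    -(1 / (2 * Real.pi)) * (∫ y : EuclideanSpace ℝ (Fin 2),
        Real.exp (-‖y‖ ^ 2 / σ ^ 2) * Real.log ‖y‖) =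
      (σ ^ 2 / 4) * (Real.eulerMascheroniConstant - Real.log (σ ^ 2)) := by
  have hball : (volume : Measure (EuclideanSpace ℝ (Fin 2))).real (Metric.ball 0 1) = Real.pi := by
    simp [Measure.real, EuclideanSpace.volume_ball_fin_two, Real.pi_pos.le]
  rw [integral_fun_norm_addHaar volume
    (fun r : ℝ => Real.exp (-r ^ 2 / σ ^ 2) * Real.log r), hball]
  simp only [finrank_euclideanSpace_fin, Nat.add_one_sub_one, pow_one, smul_eq_mul, nsmul_eq_mul]
  rw [integral_mul_exp_neg_sq_div_mul_log_Ioi (by positivity)]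
  have := Real.pi_ne_zero
  push_cast
  field_simp
  ring
end

section
/- Define ρ(y) = π e^{−π² ‖y‖²} on ℝ². Then for every x = (x₁, x₂) ∈ ℝ² with x ≠ 0, writing r = ‖x‖, the Davey–Stewartson nonlocal potential satisfies −(1/(2π)) ∫_{ℝ²} ln‖x − y‖ · (∂²ρ/∂y₁²)(y) dy = −( (π/2) e^{−π² r²} + ((x₁² − x₂²)/r²) · e^{−π² r²} (1 + π² r² − e^{π² r²}) / (2π r²) ). -/
open MeasureTheory

open Set Filter Topology

local notation "Plane" => EuclideanSpace ℝ (Fin 2)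

/-- The second derivative of `z ↦ exp (-b ‖z‖ ^ 2)` in the first coordinate direction. -/
noncomputable def gaussianSecondDeriv (b : ℝ) (y : Plane) : ℝ :=
  (4 * b ^ 2 * y 0 ^ 2 - 2 * b) * Real.exp (-b * ‖y‖ ^ 2)

lemma continuous_gaussianSecondDeriv (b : ℝ) : Continuous (gaussianSecondDeriv b) := by
  unfold gaussianSecondDeriv
  fun_prop

lemma norm_sq_eq_coord (y : Plane) : ‖y‖ ^ 2 = y 0 ^ 2 + y 1 ^ 2 := by
  simp [EuclideanSpace.norm_sq_eq]

lemma iteratedFDeriv_two_const_mul_gaussian (c b : ℝ) (y : Plane) :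
    iteratedFDeriv ℝ 2 (fun z : Plane => c * Real.exp (-b * ‖z‖ ^ 2)) y
      ![EuclideanSpace.single 0 1, EuclideanSpace.single 0 1] =
    c * gaussianSecondDeriv b y := by
  obtain ⟨L, hL⟩ : ∃ L : Plane →L[ℝ] Plane →L[ℝ] ℝ, ∀ u v, L u v = inner ℝ u v :=
    ⟨innerSL ℝ, fun _ _ => rfl⟩
  have hexp (z : Plane) : HasFDerivAt (fun z : Plane => c * Real.exp (-b * ‖z‖ ^ 2))
      ((-2 * b * (c * Real.exp (-b * ‖z‖ ^ 2))) • L z) z := by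
    have h := (((hasStrictFDerivAt_norm_sq z).hasFDerivAt.const_mul (-b)).exp).const_mul c
    refine h.congr_fderiv ?_
    ext v
    simp [hL]
    ring
  have hfd : fderiv ℝ (fun z : Plane => c * Real.exp (-b * ‖z‖ ^ 2)) =
      fun z => (-2 * b * (c * Real.exp (-b * ‖z‖ ^ 2))) • L z :=
    funext fun z => (hexp z).fderiv
  have h2 : HasFDerivAt (fun z : Plane => (-2 * b * (c * Real.exp (-b * ‖z‖ ^ 2))) • L z) _ y :=
    ((hexp y).const_mul (-2 * b)).smul L.hasFDerivAt
  rw [iteratedFDeriv_two_apply, hfd, h2.fderiv]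
  simp [gaussianSecondDeriv, EuclideanSpace.inner_single_right, hL]
  ring

/-! ### One- and two-dimensional Gaussian integrals -/

lemma integrable_sq_mul_exp_neg_mul_sq {q : ℝ} (hq : 0 < q) :
    Integrable fun w : ℝ => w ^ 2 * Real.exp (-q * w ^ 2) := by
  simpa using integrable_rpow_mul_exp_neg_mul_sq hq (s := 2) (by norm_num)

lemma integral_mul_exp_neg_mul_sq_eq_zero (q : ℝ) :
    ∫ w : ℝ, w * Real.exp (-q * w ^ 2) = 0 := by
  have h := integral_neg_eq_self (fun w : ℝ => w * Real.exp (-q * w ^ 2)) volume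
  simp only [neg_sq, neg_mul, integral_neg] at h ⊢
  linarith

lemma integral_sq_mul_exp_neg_mul_sq {q : ℝ} (hq : 0 < q) :
    ∫ w : ℝ, w ^ 2 * Real.exp (-q * w ^ 2) = √(Real.pi / q) / (2 * q) := by
  have hd (w : ℝ) : HasDerivAt (fun w : ℝ => w * Real.exp (-q * w ^ 2))
      (Real.exp (-q * w ^ 2) - 2 * q * (w ^ 2 * Real.exp (-q * w ^ 2))) w := by
    have h := (hasDerivAt_id w).mul ((((hasDerivAt_id w).pow 2).const_mul (-q)).exp)
    refine h.congr_deriv ?_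
    simp
    ring
  have h0 := integral_eq_zero_of_hasDerivAt_of_integrable hd
    ((integrable_exp_neg_mul_sq hq).sub ((integrable_sq_mul_exp_neg_mul_sq hq).const_mul _))
    (integrable_mul_exp_neg_mul_sq hq)
  rw [integral_sub (integrable_exp_neg_mul_sq hq)
    ((integrable_sq_mul_exp_neg_mul_sq hq).const_mul _), integral_const_mul,
    integral_gaussian] at h0
  rw [eq_div_iff (by positivity)]
  linarith

lemma neg_mul_sub_sq_add_neg_mul_sq {a b : ℝ} (hab : a + b ≠ 0) (t y : ℝ) :
    -a * (t - y) ^ 2 + -b * y ^ 2 =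
      -(a * b / (a + b)) * t ^ 2 + -(a + b) * (y - a * t / (a + b)) ^ 2 := by
  field_simp
  ring

lemma integral_gaussian_mul_gaussian {a b : ℝ} (hab : 0 < a + b) (t : ℝ) :
    ∫ y : ℝ, Real.exp (-a * (t - y) ^ 2) * Real.exp (-b * y ^ 2) =
      √(Real.pi / (a + b)) * Real.exp (-(a * b / (a + b)) * t ^ 2) := by
  simp_rw [← Real.exp_add, neg_mul_sub_sq_add_neg_mul_sq hab.ne', Real.exp_add]
  rw [integral_const_mul,
    integral_sub_right_eq_self (fun y : ℝ => Real.exp (-(a + b) * y ^ 2)),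
    integral_gaussian, mul_comm]

lemma integral_gaussian_mul_deriv_gaussian {a b : ℝ} (hab : 0 < a + b) (t : ℝ) :
    ∫ y : ℝ, Real.exp (-a * (t - y) ^ 2) *
        ((4 * b ^ 2 * y ^ 2 - 2 * b) * Real.exp (-b * y ^ 2)) =
      √(Real.pi / (a + b)) * Real.exp (-(a * b / (a + b)) * t ^ 2) *
        (4 * (a * b / (a + b)) ^ 2 * t ^ 2 - 2 * (a * b / (a + b))) := by
  set c := a * t / (a + b) with hc
  set K := Real.exp (-(a * b / (a + b)) * t ^ 2) with hK
  have hpt (y : ℝ) : Real.exp (-a * (t - y) ^ 2) *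
        ((4 * b ^ 2 * y ^ 2 - 2 * b) * Real.exp (-b * y ^ 2)) =
      K * (4 * b ^ 2 * ((y - c) ^ 2 * Real.exp (-(a + b) * (y - c) ^ 2)) +
        (8 * b ^ 2 * c * ((y - c) * Real.exp (-(a + b) * (y - c) ^ 2)) +
        (4 * b ^ 2 * c ^ 2 - 2 * b) * Real.exp (-(a + b) * (y - c) ^ 2))) := by
    have h : Real.exp (-a * (t - y) ^ 2) * Real.exp (-b * y ^ 2) =
        K * Real.exp (-(a + b) * (y - c) ^ 2) := by
      rw [← Real.exp_add, neg_mul_sub_sq_add_neg_mul_sq hab.ne', Real.exp_add]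
    linear_combination (4 * b ^ 2 * y ^ 2 - 2 * b) * h
  have h2 := (integrable_sq_mul_exp_neg_mul_sq hab).const_mul (4 * b ^ 2)
  have h1 := (integrable_mul_exp_neg_mul_sq hab).const_mul (8 * b ^ 2 * c)
  have h0 := (integrable_exp_neg_mul_sq hab).const_mul (4 * b ^ 2 * c ^ 2 - 2 * b)
  have h10 : Integrable fun y : ℝ => 8 * b ^ 2 * c * (y * Real.exp (-(a + b) * y ^ 2)) +
      (4 * b ^ 2 * c ^ 2 - 2 * b) * Real.exp (-(a + b) * y ^ 2) := h1.add h0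
  simp_rw [hpt]
  rw [integral_const_mul, integral_sub_right_eq_self (fun y : ℝ =>
    4 * b ^ 2 * (y ^ 2 * Real.exp (-(a + b) * y ^ 2)) +
        (8 * b ^ 2 * c * (y * Real.exp (-(a + b) * y ^ 2)) +
        (4 * b ^ 2 * c ^ 2 - 2 * b) * Real.exp (-(a + b) * y ^ 2))),
    integral_add h2 h10, integral_add h1 h0, integral_const_mul, integral_const_mul,
    integral_const_mul, integral_sq_mul_exp_neg_mul_sq hab, integral_mul_exp_neg_mul_sq_eq_zero,
    integral_gaussian, hc]
  field_simp
  ring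

lemma integral_gaussian_mul_gaussianSecondDeriv {a b : ℝ} (hab : 0 < a + b) (x : Plane) :
    ∫ y : Plane, Real.exp (-a * ‖x - y‖ ^ 2) * gaussianSecondDeriv b y =
      Real.pi / (a + b) * Real.exp (-(a * b / (a + b)) * ‖x‖ ^ 2) *
        (4 * (a * b / (a + b)) ^ 2 * x 0 ^ 2 - 2 * (a * b / (a + b))) := by
  let f : Fin 2 → ℝ → ℝ :=
    ![fun s => Real.exp (-a * (x 0 - s) ^ 2) *
        ((4 * b ^ 2 * s ^ 2 - 2 * b) * Real.exp (-b * s ^ 2)),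
      fun s => Real.exp (-a * (x 1 - s) ^ 2) * Real.exp (-b * s ^ 2)]
  have hf (y : Plane) : Real.exp (-a * ‖x - y‖ ^ 2) * gaussianSecondDeriv b y =
      ∏ i, f i (WithLp.ofLp y i) := by
    simp only [Fin.prod_univ_two, f, gaussianSecondDeriv, norm_sq_eq_coord, mul_add, Real.exp_add,
      Matrix.cons_val_zero, Matrix.cons_val_one, PiLp.sub_apply]
    ring
  simp_rw [hf]
  rw [(PiLp.volume_preserving_ofLp (Fin 2)).integral_comp
    (MeasurableEquiv.toLp 2 (Fin 2 → ℝ)).symm.measurableEmbedding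
    (fun v : Fin 2 → ℝ => ∏ i, f i (v i)),
    integral_fintype_prod_volume_eq_prod f, Fin.prod_univ_two]
  simp only [f, Matrix.cons_val_zero, Matrix.cons_val_one]
  rw [integral_gaussian_mul_gaussian hab, integral_gaussian_mul_deriv_gaussian hab,
    norm_sq_eq_coord, mul_add, Real.exp_add]
  have hs : √(Real.pi / (a + b)) * √(Real.pi / (a + b)) = Real.pi / (a + b) :=
    Real.mul_self_sqrt (by positivity)
  linear_combination (Real.exp (-(a * b / (a + b)) * x 0 ^ 2) *
    Real.exp (-(a * b / (a + b)) * x 1 ^ 2) *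
    (4 * (a * b / (a + b)) ^ 2 * x 0 ^ 2 - 2 * (a * b / (a + b)))) * hs

/-! ### The logarithm as a superposition of Gaussians -/

/-- The integrand of Frullani's integral for `log s`. -/
noncomputable def frullaniKernel (s a : ℝ) : ℝ :=
  a⁻¹ * (Real.exp (-a) - Real.exp (-a * s))

lemma abs_exp_sub_exp_le (u v : ℝ) :
    |Real.exp u - Real.exp v| ≤ |u - v| * Real.exp (max u v) := by
  wlog h : v ≤ u generalizing u v
  · rw [abs_sub_comm, abs_sub_comm u, max_comm]
    exact this v u (le_of_not_ge h)
  rw [max_eq_left h, abs_of_nonneg (sub_nonneg.2 (Real.exp_le_exp.2 h)),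
    abs_of_nonneg (sub_nonneg.2 h)]
  have h1 := Real.add_one_le_exp (v - u)
  have h2 : Real.exp v = Real.exp u * Real.exp (v - u) := by rw [← Real.exp_add]; ring_nf
  nlinarith [Real.exp_pos u]

lemma integrableOn_frullaniKernel {s : ℝ} (hs : 0 < s) :
    IntegrableOn (frullaniKernel s) (Ioi 0) := by
  have hm : 0 < min 1 s := lt_min one_pos hs
  refine Integrable.mono' ((exp_neg_integrableOn_Ioi 0 hm).const_mul |s - 1|)
    (Measurable.aestronglyMeasurable (by unfold frullaniKernel; fun_prop)) ?_
  filter_upwards [ae_restrict_mem measurableSet_Ioi] with a ha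
  have ha : 0 < a := ha
  have h := abs_exp_sub_exp_le (-a) (-a * s)
  have hmax : max (-a) (-a * s) ≤ -min 1 s * a := by
    refine max_le ?_ ?_
    · nlinarith [min_le_left 1 s]
    · nlinarith [min_le_right 1 s]
  rw [show -a - -a * s = a * (s - 1) by ring, abs_mul, abs_of_pos ha] at h
  rw [frullaniKernel, norm_mul, Real.norm_eq_abs, Real.norm_eq_abs, abs_of_pos (inv_pos.2 ha)]
  calc a⁻¹ * |Real.exp (-a) - Real.exp (-a * s)|
      ≤ a⁻¹ * (a * |s - 1| * Real.exp (-min 1 s * a)) := by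
        gcongr
        exact h.trans (by gcongr)
    _ = |s - 1| * Real.exp (-min 1 s * a) := by field_simp

lemma integral_frullaniKernel {s : ℝ} (hs : 0 < s) :
    ∫ a in Ioi 0, frullaniKernel s a = Real.log s := by
  have h := Frullani.integral_Ioi_eq (f := fun a : ℝ => Real.exp (-a)) (a := 1) (b := s)
    (L := 1) (R := 0)
    ((Real.continuous_exp.comp continuous_neg).locallyIntegrable.locallyIntegrableOn _) one_pos hs
    (by
      have : Tendsto (fun a : ℝ => Real.exp (-a)) (𝓝 0) (𝓝 (Real.exp (-0))) :=
        Continuous.tendsto (by fun_prop) 0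
      simpa using this.mono_left nhdsWithin_le_nhds)
    Real.tendsto_exp_neg_atTop_nhds_zero
    ((integrableOn_frullaniKernel hs).congr_fun
      (fun a _ => by simp [frullaniKernel, mul_comm]) measurableSet_Ioi)
  simpa [frullaniKernel, mul_comm] using h

lemma integral_norm_frullaniKernel {s : ℝ} (hs : 0 < s) :
    ∫ a in Ioi 0, ‖frullaniKernel s a‖ = |Real.log s| := by
  rw [← integral_frullaniKernel hs]
  rcases le_total 1 s with h | h
  · have hk : ∀ a ∈ Ioi (0 : ℝ), 0 ≤ frullaniKernel s a := fun a ha => by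
      have ha : 0 < a := ha
      have : Real.exp (-a * s) ≤ Real.exp (-a) := Real.exp_le_exp.2 (by nlinarith)
      exact mul_nonneg (inv_pos.2 ha).le (sub_nonneg.2 this)
    rw [abs_of_nonneg (setIntegral_nonneg measurableSet_Ioi hk)]
    exact setIntegral_congr_fun measurableSet_Ioi fun a ha => Real.norm_of_nonneg (hk a ha)
  · have hk : ∀ a ∈ Ioi (0 : ℝ), frullaniKernel s a ≤ 0 := fun a ha => by
      have ha : 0 < a := ha
      have : Real.exp (-a) ≤ Real.exp (-a * s) := Real.exp_le_exp.2 (by nlinarith)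
      exact mul_nonpos_of_nonneg_of_nonpos (inv_pos.2 ha).le (sub_nonpos.2 this)
    rw [abs_of_nonpos (setIntegral_nonpos measurableSet_Ioi hk), ← integral_neg]
    exact setIntegral_congr_fun measurableSet_Ioi fun a ha => Real.norm_of_nonpos (hk a ha)

/-! ### Integrability -/

lemma integrable_exp_neg_mul_norm_sq {c : ℝ} (hc : 0 < c) :
    Integrable fun y : Plane => Real.exp (-c * ‖y‖ ^ 2) := by
  refine Integrable.of_integral_ne_zero ?_
  rw [GaussianFourier.integral_rexp_neg_mul_sq_norm hc]
  positivity

lemma integrable_one_add_norm_sq_mul_gaussianSecondDeriv {b : ℝ} (hb : 0 < b) :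
    Integrable fun y : Plane => (1 + ‖y‖ ^ 2) * gaussianSecondDeriv b y := by
  have hc : 0 < b / 4 := by positivity
  refine Integrable.mono' ((integrable_exp_neg_mul_norm_sq (c := b / 2) (by positivity)).const_mul
    ((4 * b ^ 2 + 2 * b) * (1 + 4 / b) ^ 2))
    (((by fun_prop : Continuous fun y : Plane => 1 + ‖y‖ ^ 2).mul
      (continuous_gaussianSecondDeriv b)).aestronglyMeasurable) (ae_of_all _ fun y => ?_)
  set t := ‖y‖ ^ 2 with ht
  have ht0 : 0 ≤ t := by positivity
  have hy : y 0 ^ 2 ≤ t := by rw [ht, norm_sq_eq_coord]; nlinarith [sq_nonneg (y 1)]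
  have hpoly : |4 * b ^ 2 * y 0 ^ 2 - 2 * b| ≤ (4 * b ^ 2 + 2 * b) * (1 + t) := by
    rw [abs_le]
    constructor <;> nlinarith [mul_pos hb hb, mul_nonneg (mul_pos hb hb).le (sub_nonneg.2 hy),
      mul_nonneg hb.le ht0, mul_nonneg (mul_pos hb hb).le ht0,
      mul_nonneg (mul_pos hb hb).le (sq_nonneg (y 0))]
  have hexp : 1 + t ≤ (1 + 4 / b) * Real.exp (b / 4 * t) := by
    have h1 := Real.add_one_le_exp (b / 4 * t)
    have h2 : 1 ≤ Real.exp (b / 4 * t) := Real.one_le_exp (by positivity)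
    have h3 : t ≤ 4 / b * Real.exp (b / 4 * t) := by
      calc t = 4 / b * (b / 4 * t) := by field_simp
        _ ≤ 4 / b * Real.exp (b / 4 * t) := by gcongr; linarith
    linarith
  have hsplit : Real.exp (b / 4 * t) ^ 2 * Real.exp (-b * t) = Real.exp (-(b / 2) * t) := by
    rw [← Real.exp_nat_mul, ← Real.exp_add]
    congr 1
    push_cast
    ring
  rw [gaussianSecondDeriv, norm_mul, norm_mul, Real.norm_eq_abs, Real.norm_eq_abs, Real.norm_eq_abs,
    Real.abs_exp, abs_of_nonneg (by positivity : (0 : ℝ) ≤ 1 + t), ← ht, ← hsplit]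
  calc (1 + t) * (|4 * b ^ 2 * y 0 ^ 2 - 2 * b| * Real.exp (-b * t))
      ≤ (1 + t) * ((4 * b ^ 2 + 2 * b) * (1 + t) * Real.exp (-b * t)) := by gcongr
    _ = (4 * b ^ 2 + 2 * b) * (1 + t) ^ 2 * Real.exp (-b * t) := by ring
    _ ≤ (4 * b ^ 2 + 2 * b) * ((1 + 4 / b) * Real.exp (b / 4 * t)) ^ 2 * Real.exp (-b * t) := by
        gcongr
    _ = _ := by ring

lemma integrable_gaussianSecondDeriv {b : ℝ} (hb : 0 < b) :
    Integrable (gaussianSecondDeriv b) := by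
  refine (integrable_one_add_norm_sq_mul_gaussianSecondDeriv hb).mono
    (continuous_gaussianSecondDeriv b).aestronglyMeasurable (ae_of_all _ fun y => ?_)
  rw [norm_mul, Real.norm_of_nonneg (by positivity : (0 : ℝ) ≤ 1 + ‖y‖ ^ 2)]
  exact le_mul_of_one_le_left (norm_nonneg _) (by nlinarith [sq_nonneg ‖y‖])

lemma abs_gaussianSecondDeriv_le {b : ℝ} (hb : 0 < b) (y : Plane) :
    |gaussianSecondDeriv b y| ≤ 6 * b := by
  have hy : y 0 ^ 2 ≤ ‖y‖ ^ 2 := by rw [norm_sq_eq_coord]; nlinarith [sq_nonneg (y 1)]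
  have h1 : Real.exp (-b * ‖y‖ ^ 2) ≤ 1 := Real.exp_le_one_iff.2 (by nlinarith [sq_nonneg ‖y‖])
  have h2 : b * ‖y‖ ^ 2 * Real.exp (-b * ‖y‖ ^ 2) ≤ 1 := by
    have h := Real.add_one_le_exp (b * ‖y‖ ^ 2)
    rw [neg_mul, Real.exp_neg, ← div_eq_mul_inv, div_le_one (Real.exp_pos _)]
    linarith
  have h3 := Real.exp_pos (-b * ‖y‖ ^ 2)
  have h4 : b * y 0 ^ 2 * Real.exp (-b * ‖y‖ ^ 2) ≤ 1 := le_trans (by gcongr) h2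
  have h5 : 0 ≤ b * y 0 ^ 2 * Real.exp (-b * ‖y‖ ^ 2) := by positivity
  rw [gaussianSecondDeriv, abs_le]
  constructor <;> nlinarith

lemma integrableOn_log_norm_ball :
    IntegrableOn (fun z : Plane => Real.log ‖z‖) (Metric.ball 0 1) := by
  rw [integrableOn_fun_norm_addHaar volume (f := Real.log)]
  have h : IntegrableOn (fun r : ℝ => r * Real.log r) (Icc 0 1) :=
    Real.continuous_mul_log.continuousOn.integrableOn_compact isCompact_Icc
  simpa using h.mono_set Ioo_subset_Icc_self

lemma integrable_log_norm_sub_mul_gaussianSecondDeriv {b : ℝ} (hb : 0 < b) (x : Plane) :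
    Integrable fun y : Plane => Real.log ‖x - y‖ * gaussianSecondDeriv b y := by
  have hloc : Integrable fun y : Plane =>
      (Metric.ball (0 : Plane) 1).indicator (fun z => Real.log ‖z‖) (x - y) :=
    (integrableOn_log_norm_ball.integrable_indicator measurableSet_ball).comp_sub_left x
  refine Integrable.mono' ((hloc.norm.mul_const (6 * b)).add
    ((integrable_one_add_norm_sq_mul_gaussianSecondDeriv hb).norm.const_mul (‖x‖ + 1)))
    ((Measurable.aestronglyMeasurable (by fun_prop)).mul
      (continuous_gaussianSecondDeriv b).aestronglyMeasurable) (ae_of_all _ fun y => ?_)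
  have hG := abs_gaussianSecondDeriv_le hb y
  rw [Pi.add_apply, norm_mul, norm_mul, Real.norm_of_nonneg (by positivity : (0 : ℝ) ≤ 1 + ‖y‖ ^ 2),
    ← mul_assoc (‖x‖ + 1), Real.norm_eq_abs (gaussianSecondDeriv b y)]
  by_cases h : ‖x - y‖ < 1
  · rw [indicator_of_mem (by simpa using h)]
    exact le_add_of_le_of_nonneg (mul_le_mul_of_nonneg_left hG (norm_nonneg _)) (by positivity)
  · have h1 : 1 ≤ ‖x - y‖ := le_of_not_gt h
    refine le_add_of_nonneg_of_le (by positivity) ?_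
    refine mul_le_mul_of_nonneg_right ?_ (abs_nonneg _)
    rw [Real.norm_of_nonneg (Real.log_nonneg h1)]
    have h2 := Real.log_le_sub_one_of_pos (zero_lt_one.trans_le h1)
    nlinarith [norm_sub_le x y, sq_nonneg (‖y‖ - 1), norm_nonneg x, norm_nonneg y,
      mul_nonneg (norm_nonneg x) (sq_nonneg ‖y‖)]

lemma integrable_frullaniKernel_mul_gaussianSecondDeriv {b : ℝ} (hb : 0 < b) (x : Plane) :
    Integrable (Function.uncurry fun (y : Plane) (a : ℝ) =>
      frullaniKernel (‖x - y‖ ^ 2) a * gaussianSecondDeriv b y)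
      (volume.prod (volume.restrict (Ioi 0))) := by
  have hmeas : Measurable (Function.uncurry fun (y : Plane) (a : ℝ) =>
      frullaniKernel (‖x - y‖ ^ 2) a * gaussianSecondDeriv b y) := by
    have := (continuous_gaussianSecondDeriv b).measurable
    unfold frullaniKernel Function.uncurry
    fun_prop
  have hne : ∀ᵐ y : Plane, y ≠ x := by simp [ae_iff]
  rw [integrable_prod_iff hmeas.aestronglyMeasurable]
  constructor
  · filter_upwards [hne] with y hy
    have : 0 < ‖x - y‖ ^ 2 := by have := norm_pos_iff.2 (sub_ne_zero.2 hy.symm); positivity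
    exact (integrableOn_frullaniKernel this).mul_const (gaussianSecondDeriv b y)
  · refine ((integrable_log_norm_sub_mul_gaussianSecondDeriv hb x).norm.const_mul 2).congr ?_
    filter_upwards [hne] with y hy
    have : 0 < ‖x - y‖ ^ 2 := by have := norm_pos_iff.2 (sub_ne_zero.2 hy.symm); positivity
    simp only [Function.uncurry_apply_pair, norm_mul]
    rw [integral_mul_const, integral_norm_frullaniKernel this, Real.log_pow, abs_mul,
      Real.norm_eq_abs (Real.log _)]
    simp [mul_assoc]

/-! ### Evaluation of the logarithmic potential -/

lemma integral_frullaniKernel_mul_gaussianSecondDeriv {a b : ℝ} (ha : 0 < a) (hb : 0 < b)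
    (x : Plane) :
    ∫ y : Plane, frullaniKernel (‖x - y‖ ^ 2) a * gaussianSecondDeriv b y =
      -(Real.pi * b / (a + b) ^ 2) * Real.exp (-(a * b / (a + b)) * ‖x‖ ^ 2) *
        (4 * (a * b / (a + b)) * x 0 ^ 2 - 2) := by
  have h0 : ∫ y : Plane, gaussianSecondDeriv b y = 0 := by
    simpa using integral_gaussian_mul_gaussianSecondDeriv (a := 0) (b := b) (by simpa) x
  have hG := integrable_gaussianSecondDeriv hb
  have hint : Integrable fun y : Plane => Real.exp (-a * ‖x - y‖ ^ 2) * gaussianSecondDeriv b y := by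
    refine hG.mono (Continuous.aestronglyMeasurable
      ((by fun_prop : Continuous fun y : Plane => Real.exp (-a * ‖x - y‖ ^ 2)).mul
      (continuous_gaussianSecondDeriv b))) (ae_of_all _ fun y => ?_)
    rw [norm_mul, Real.norm_eq_abs, Real.abs_exp]
    exact mul_le_of_le_one_left (norm_nonneg _)
      (Real.exp_le_one_iff.2 (by nlinarith [sq_nonneg ‖x - y‖]))
  have hpt (y : Plane) : frullaniKernel (‖x - y‖ ^ 2) a * gaussianSecondDeriv b y =
      a⁻¹ * (Real.exp (-a) * gaussianSecondDeriv b y -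
        Real.exp (-a * ‖x - y‖ ^ 2) * gaussianSecondDeriv b y) := by
    rw [frullaniKernel]
    ring
  simp_rw [hpt]
  rw [integral_const_mul, integral_sub (hG.const_mul _) hint, integral_const_mul, h0,
    integral_gaussian_mul_gaussianSecondDeriv (by positivity)]
  field_simp
  ring

theorem integral_log_norm_sub_mul_gaussianSecondDeriv {b : ℝ} (hb : 0 < b) {x : Plane} (hx : x ≠ 0) :
    ∫ y : Plane, Real.log ‖x - y‖ * gaussianSecondDeriv b y =
      Real.pi / b * (Real.exp (-b * ‖x‖ ^ 2) *
          (2 * b * x 0 ^ 2 / ‖x‖ ^ 2 + (x 0 ^ 2 - x 1 ^ 2) / ‖x‖ ^ 4) -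
        (x 0 ^ 2 - x 1 ^ 2) / ‖x‖ ^ 4) := by
  have hr : 0 < ‖x‖ := norm_pos_iff.2 hx
  have hprod := integrable_frullaniKernel_mul_gaussianSecondDeriv hb x
  have hlog : ∫ y : Plane, Real.log ‖x - y‖ * gaussianSecondDeriv b y =
      1 / 2 * ∫ y : Plane, ∫ a in Ioi 0, frullaniKernel (‖x - y‖ ^ 2) a * gaussianSecondDeriv b y := by
    rw [← integral_const_mul]
    refine integral_congr_ae ?_
    have hne : ∀ᵐ y : Plane, y ≠ x := by simp [ae_iff]
    filter_upwards [hne] with y hy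
    have : 0 < ‖x - y‖ ^ 2 := by have := norm_pos_iff.2 (sub_ne_zero.2 hy.symm); positivity
    rw [integral_mul_const, integral_frullaniKernel this, Real.log_pow]
    push_cast
    ring
  let p : ℝ → ℝ := fun a => a * b / (a + b)
  let F : ℝ → ℝ := fun a => Real.pi / b * (Real.exp (-p a * ‖x‖ ^ 2) *
    (4 * x 0 ^ 2 / ‖x‖ ^ 2 * p a + 2 * (x 0 ^ 2 - x 1 ^ 2) / ‖x‖ ^ 4))
  have hp {a : ℝ} (ha : 0 ≤ a) : HasDerivAt p (b ^ 2 / (a + b) ^ 2) a := by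
    have hab : a + b ≠ 0 := by positivity
    refine (((hasDerivAt_id a).mul_const b).div ((hasDerivAt_id a).add_const b) hab).congr_deriv ?_
    simp
    ring
  have hF : ∀ a ∈ Ioi (0 : ℝ), HasDerivAt F
      (∫ y : Plane, frullaniKernel (‖x - y‖ ^ 2) a * gaussianSecondDeriv b y) a := by
    intro a ha
    have ha : 0 < a := ha
    have hab : a + b ≠ 0 := by positivity
    have hd := ((((hp ha.le).neg.mul_const (‖x‖ ^ 2)).exp).mul
      (((hp ha.le).const_mul (4 * x 0 ^ 2 / ‖x‖ ^ 2)).add_const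
        (2 * (x 0 ^ 2 - x 1 ^ 2) / ‖x‖ ^ 4))).const_mul (Real.pi / b)
    refine hd.congr_deriv ?_
    rw [integral_frullaniKernel_mul_gaussianSecondDeriv ha hb]
    have hx1 : x 1 ^ 2 = ‖x‖ ^ 2 - x 0 ^ 2 := by rw [norm_sq_eq_coord]; ring
    simp only [p, hx1, Pi.neg_apply]
    field_simp
    ring
  have hF0 : ContinuousWithinAt F (Ici 0) 0 := by
    have := (hp le_rfl).continuousAt
    exact ContinuousAt.continuousWithinAt (by fun_prop)
  have hplim : Tendsto p atTop (𝓝 b) := by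
    have h : Tendsto (fun a : ℝ => b - b ^ 2 * (a + b)⁻¹) atTop (𝓝 (b - b ^ 2 * 0)) :=
      ((tendsto_inv_atTop_zero.comp (tendsto_atTop_add_const_right _ b tendsto_id)).const_mul
        _).const_sub b
    rw [mul_zero, sub_zero] at h
    refine h.congr' ?_
    filter_upwards [eventually_ge_atTop 0] with a ha
    have : a + b ≠ 0 := by positivity
    simp only [p]
    field_simp
    ring
  have hFlim : Tendsto F atTop (𝓝 (Real.pi / b * (Real.exp (-b * ‖x‖ ^ 2) *
      (4 * x 0 ^ 2 / ‖x‖ ^ 2 * b + 2 * (x 0 ^ 2 - x 1 ^ 2) / ‖x‖ ^ 4)))) := by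
    have : Continuous fun q : ℝ => Real.pi / b * (Real.exp (-q * ‖x‖ ^ 2) *
      (4 * x 0 ^ 2 / ‖x‖ ^ 2 * q + 2 * (x 0 ^ 2 - x 1 ^ 2) / ‖x‖ ^ 4)) := by fun_prop
    exact (this.tendsto b).comp hplim
  rw [hlog, integral_integral_swap hprod,
    integral_Ioi_of_hasDerivAt_of_tendsto hF0 hF hprod.integral_prod_right hFlim]
  simp [F, p]
  field_simp
  ring

/-- The Davey–Stewartson nonlocal potential of the Gaussian `ρ(y) = π e^{−π²‖y‖²}`:
for `x ≠ 0` with `r = ‖x‖`,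
`−(1/2π) ∫ ln‖x−y‖ (∂²ρ/∂y₁²)(y) dy
  = −((π/2) e^{−π²r²} + ((x₁²−x₂²)/r²) e^{−π²r²} (1+π²r²−e^{π²r²})/(2πr²))`. -/
theorem davey_stewartson_gaussian_potential
    (x : EuclideanSpace ℝ (Fin 2)) (hx : x ≠ 0) :
    -(1 / (2 * Real.pi)) * (∫ y : EuclideanSpace ℝ (Fin 2),
        Real.log ‖x - y‖ *
          iteratedFDeriv ℝ 2
            (fun z : EuclideanSpace ℝ (Fin 2) => Real.pi * Real.exp (-Real.pi ^ 2 * ‖z‖ ^ 2)) y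
            ![EuclideanSpace.single 0 1, EuclideanSpace.single 0 1]) =
      -((Real.pi / 2) * Real.exp (-Real.pi ^ 2 * ‖x‖ ^ 2) +
        ((x 0 ^ 2 - x 1 ^ 2) / ‖x‖ ^ 2) * Real.exp (-Real.pi ^ 2 * ‖x‖ ^ 2) *
          (1 + Real.pi ^ 2 * ‖x‖ ^ 2 - Real.exp (Real.pi ^ 2 * ‖x‖ ^ 2)) /
            (2 * Real.pi * ‖x‖ ^ 2)) := by
  have hr : 0 < ‖x‖ := norm_pos_iff.2 hx
  simp_rw [iteratedFDeriv_two_const_mul_gaussian Real.pi (Real.pi ^ 2), mul_left_comm _ Real.pi]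
  rw [integral_const_mul, integral_log_norm_sub_mul_gaussianSecondDeriv (by positivity) hx]
  have hE : Real.exp (-Real.pi ^ 2 * ‖x‖ ^ 2) *
      (1 + Real.pi ^ 2 * ‖x‖ ^ 2 - Real.exp (Real.pi ^ 2 * ‖x‖ ^ 2)) =
      Real.exp (-Real.pi ^ 2 * ‖x‖ ^ 2) * (1 + Real.pi ^ 2 * ‖x‖ ^ 2) - 1 := by
    rw [mul_sub, ← Real.exp_add]
    simp
  have hx0 : x 0 ^ 2 = ‖x‖ ^ 2 - x 1 ^ 2 := by rw [norm_sq_eq_coord]; ring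
  rw [mul_assoc (_ / _) (Real.exp _), hE, hx0]
  field_simp
  ring
end
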